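/- arXiv:2406.01019 — 3 statements merged into one kernel-verified Lean document; each statement's English description precedes it below -/
import Mathlib

section
/- Let $k$ be a field of characteristic zero, let $r, t_1, s_1, t_2, s_2 \geq 0$ be integers with $t_2 \leq t_1$ and $(t_1, s_1) \neq (t_2, s_2)$, and let $c_1, c_2 \in k$. Then the $k$-derivation $d = y^r\partial_x + (c_1 x^{t_1} y^{s_1} + c_2 x^{t_2} y^{s_2})\partial_y$ of $k[x,y]$ is simple if and only if all of the following hold: (a) $c_1 \neq 0$, $c_2 \neq 0$ and $t_2 < t_1$; (b) if $r > 0$, then $t_2 = s_2 = 0$ and $s_1 > 0$; (c) if $r = 0$, then $s_1 + s_2 > 0$ and $s_1 s_2 = 0$; (d) if $r = s_1 = 0$ and $s_2 = 1$, then $(t_2 + 1) \nmid (t_1 - t_2)$. -/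
open MvPolynomial

/-- A `k`-derivation `d` of `k[x,y]` is *simple* if the only `d`-differential ideals
(ideals `I` with `d(I) ⊆ I`) are `(0)` and the whole ring. Here `k[x,y]` is modelled as
`MvPolynomial (Fin 2) k`, with `x = X 0` and `y = X 1`. -/
def IsSimpleDerivation {k : Type*} [CommRing k]
    (d : Derivation k (MvPolynomial (Fin 2) k) (MvPolynomial (Fin 2) k)) : Prop :=
  ∀ I : Ideal (MvPolynomial (Fin 2) k), (∀ f ∈ I, d f ∈ I) → I = ⊥ ∨ I = ⊤


namespace SD
noncomputable section
variable {k : Type*} [Field k]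

/-- embedding of polynomials into rational functions -/
abbrev io (p : Polynomial k) : RatFunc k := algebraMap (Polynomial k) (RatFunc k) p

lemma io_inj {p q : Polynomial k} (h : io p = io q) : p = q :=
  RatFunc.algebraMap_injective k h

lemma io_ne {p : Polynomial k} (h : p ≠ 0) : io p ≠ 0 := by
  intro h'; apply h; apply io_inj; rw [h']; simp [io]

def rdq (p q : Polynomial k) : RatFunc k :=
  (io (Polynomial.derivative p) * io q - io p * io (Polynomial.derivative q)) / (io q) ^ 2

lemma rdq_eq {p q p' q' : Polynomial k} (hq : q ≠ 0) (hq' : q' ≠ 0)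
    (h : io p / io q = io p' / io q') : rdq p q = rdq p' q' := by
  have h1 := io_ne hq
  have h2 := io_ne hq'
  rw [div_eq_div_iff h1 h2] at h
  have h3 : p * q' = p' * q := by apply io_inj; simpa [io] using h
  have h4 := congrArg Polynomial.derivative h3
  simp only [Polynomial.derivative_mul] at h4
  have h5 := congrArg (io (k := k)) h4
  simp only [io, map_add, map_mul] at h5 h h1 h2
  unfold rdq
  rw [div_eq_div_iff (pow_ne_zero 2 h1) (pow_ne_zero 2 h2)]
  simp only [io]
  set A := algebraMap (Polynomial k) (RatFunc k)
  linear_combination (A q * A q') * h5 - (A (Polynomial.derivative q) * A q' +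
    A q * A (Polynomial.derivative q')) * h

/-- derivation on rational functions -/
def rd (R : RatFunc k) : RatFunc k := rdq R.num R.denom

lemma rd_div {p q : Polynomial k} (hq : q ≠ 0) : rd (io p / io q) = rdq p q := by
  unfold rd
  apply rdq_eq (RatFunc.denom_ne_zero _) hq
  exact RatFunc.num_div_denom _

lemma exists_rep (R : RatFunc k) : ∃ p q : Polynomial k, q ≠ 0 ∧ IsCoprime p q ∧ R = io p / io q :=
  ⟨R.num, R.denom, RatFunc.denom_ne_zero _, RatFunc.isCoprime_num_denom R,
    (RatFunc.num_div_denom _).symm⟩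

lemma rd_add (R S : RatFunc k) : rd (R + S) = rd R + rd S := by
  obtain ⟨p, q, hq, -, rfl⟩ := exists_rep R
  obtain ⟨p', q', hq', -, rfl⟩ := exists_rep S
  have h1 := io_ne hq
  have h2 := io_ne hq'
  have : io p / io q + io p' / io q' = io (p * q' + p' * q) / io (q * q') := by
    simp only [io, map_add, map_mul] at *
    field_simp
  rw [this, rd_div (mul_ne_zero hq hq'), rd_div hq, rd_div hq']
  unfold rdq
  simp only [io, map_add, map_mul, Polynomial.derivative_add, Polynomial.derivative_mul] at *
  field_simp
  ring

lemma rd_mul (R S : RatFunc k) : rd (R * S) = rd R * S + R * rd S := by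
  obtain ⟨p, q, hq, -, rfl⟩ := exists_rep R
  obtain ⟨p', q', hq', -, rfl⟩ := exists_rep S
  have h1 := io_ne hq
  have h2 := io_ne hq'
  have : io p / io q * (io p' / io q') = io (p * p') / io (q * q') := by
    simp only [io, map_mul] at *
    field_simp
  rw [this, rd_div (mul_ne_zero hq hq'), rd_div hq, rd_div hq']
  unfold rdq
  simp only [io, map_add, map_mul, Polynomial.derivative_mul] at *
  field_simp
  ring

lemma rd_io (p : Polynomial k) : rd (io p) = io (Polynomial.derivative p) := by
  have : io p = io p / io 1 := by simp [io]
  rw [this, rd_div one_ne_zero]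
  simp [rdq, io]

lemma rd_zero : rd (0 : RatFunc k) = 0 := by
  have := rd_io (0 : Polynomial k)
  simpa [io] using this

/-- as additive hom -/
def rdH : RatFunc k →+ RatFunc k where
  toFun := rd
  map_zero' := rd_zero
  map_add' := rd_add

/-- key lemma: denominators of antiderivatives -/
lemma rat_lemma [CharZero k] {e Z : Polynomial k} (he : Squarefree e) (he0 : e ≠ 0) (R : RatFunc k)
    (h : io e ^ 2 * rd R = io Z) : ∃ N : Polynomial k, io e * R = io N := by
  obtain ⟨p, g, hg, hpg, rfl⟩ := exists_rep R
  rw [rd_div hg] at h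
  have hg' := io_ne hg
  have h1 : e ^ 2 * (Polynomial.derivative p * g - p * Polynomial.derivative g) = Z * g ^ 2 := by
    apply io_inj
    unfold rdq at h
    simp only [io, map_mul, map_sub, map_pow] at *
    field_simp at h
    linear_combination h
  have key : g ∣ e := by
    classical
    -- every irreducible power
    have hmain : ∀ (π : Polynomial k), Irreducible π → ∀ q : ℕ, ∀ γ : Polynomial k,
        g = π ^ (q + 1) * γ → ¬ π ∣ γ → π ∣ e ∧ q = 0 := by
      intro π hπ q γ hgγ hγ
      have hpr : Prime π := hπ.prime
      have hπp : ¬ π ∣ p := by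
        intro hd
        apply hπ.not_isUnit
        exact hpg.isUnit_of_dvd' hd ⟨π ^ q * γ, by rw [hgγ]; ring⟩
      have hπd : ¬ π ∣ Polynomial.derivative π := by
        intro hd
        have hdeg : 0 < π.natDegree := by
          rcases Nat.eq_zero_or_pos π.natDegree with h0 | h0
          · exfalso
            rw [Polynomial.natDegree_eq_zero] at h0
            obtain ⟨c, rfl⟩ := h0
            have hc : c ≠ 0 := by rintro rfl; exact hπ.ne_zero (by simp)
            exact hπ.not_isUnit (Polynomial.isUnit_C.2 (isUnit_iff_ne_zero.2 hc))
          · exact h0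
        have hne : Polynomial.derivative π ≠ 0 := by
          intro h0
          have := Polynomial.natDegree_eq_zero_of_derivative_eq_zero h0
          omega
        have h3 := Polynomial.natDegree_le_of_dvd hd hne
        have h4 := Polynomial.natDegree_derivative_lt (p := π) (by omega)
        omega
      have hdg : Polynomial.derivative p * g - p * Polynomial.derivative g
          = π ^ q * (π * (Polynomial.derivative p * γ - p * Polynomial.derivative γ)
            - Polynomial.C ((q : k) + 1) * (p * γ * Polynomial.derivative π)) := by
        rw [hgγ]
        simp only [Polynomial.derivative_mul, Polynomial.derivative_pow]
        simp
        ring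
      have hcof : ¬ π ∣ (π * (Polynomial.derivative p * γ - p * Polynomial.derivative γ)
            - Polynomial.C ((q : k) + 1) * (p * γ * Polynomial.derivative π)) := by
        intro hd
        have h5 := (dvd_sub_right (dvd_mul_right π _)).1 hd
        rcases hpr.dvd_or_dvd h5 with h6 | h6
        · have hu : IsUnit (Polynomial.C ((q : k) + 1)) :=
            Polynomial.isUnit_C.2 (isUnit_iff_ne_zero.2 (by exact_mod_cast Nat.succ_ne_zero q))
          exact hπ.not_isUnit (isUnit_of_dvd_unit h6 hu)
        · rcases hpr.dvd_or_dvd h6 with h6 | h6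
          · rcases hpr.dvd_or_dvd h6 with h6 | h6
            · exact hπp h6
            · exact hγ h6
          · exact hπd h6
      rw [hdg] at h1
      set T := (π * (Polynomial.derivative p * γ - p * Polynomial.derivative γ)
            - Polynomial.C ((q : k) + 1) * (p * γ * Polynomial.derivative π)) with hT
      have h7 : e ^ 2 * T = π ^ (q + 2) * (Z * γ ^ 2) := by
        have hπq : π ^ q ≠ 0 := pow_ne_zero _ hπ.ne_zero
        apply mul_left_cancel₀ hπq
        rw [hgγ] at h1
        linear_combination h1
      have h8 : π ^ (q + 2) ∣ e ^ 2 :=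
        (hpr.pow_dvd_of_dvd_mul_right _ hcof ⟨_, h7⟩)
      have h9 : π ∣ e := hpr.dvd_of_dvd_pow ((dvd_pow_self π (by omega)).trans h8)
      refine ⟨h9, ?_⟩
      by_contra hq
      obtain ⟨ε, hε⟩ := h9
      have hε' : ¬ π ∣ ε := by
        rintro ⟨τ, rfl⟩
        exact hπ.not_isUnit (he π ⟨τ, by rw [hε]; ring⟩)
      have h10 : π ^ 3 ∣ e ^ 2 := (pow_dvd_pow π (by omega)).trans h8
      obtain ⟨y, hy⟩ := h10
      rw [hε] at hy
      have h11 : ε ^ 2 = π * y := by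
        apply mul_left_cancel₀ (pow_ne_zero 2 hπ.ne_zero)
        linear_combination hy
      exact hε' (hpr.dvd_of_dvd_pow ⟨y, h11⟩)
    have hsq : Squarefree g := by
      rw [squarefree_iff_irreducible_sq_not_dvd_of_ne_zero hg]
      intro π hπ hd
      obtain ⟨n, γ, hγ, hgγ⟩ := WfDvdMonoid.max_power_factor hg hπ
      cases n with
      | zero =>
        apply hγ
        rw [pow_zero, one_mul] at hgγ
        rw [← hgγ]
        exact (dvd_mul_right π π).trans hd
      | succ n =>
        obtain ⟨-, rfl⟩ := hmain π hπ n γ hgγ hγ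
        obtain ⟨y, hy⟩ := hd
        apply hγ
        refine ⟨y, mul_left_cancel₀ hπ.ne_zero ?_⟩
        rw [hgγ] at hy
        linear_combination hy
    rw [UniqueFactorizationMonoid.dvd_iff_normalizedFactors_le_normalizedFactors hg he0] 
    rw [Multiset.le_iff_subset]
    · intro π hm
      have hπ := UniqueFactorizationMonoid.irreducible_of_normalized_factor π hm
      have hd := UniqueFactorizationMonoid.dvd_of_mem_normalizedFactors hm
      obtain ⟨n, γ, hγ, hgγ⟩ := WfDvdMonoid.max_power_factor hg hπ
      cases n with
      | zero =>
        exfalso; apply hγ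
        rw [pow_zero, one_mul] at hgγ
        rwa [← hgγ]
      | succ n =>
        have h9 := (hmain π hπ n γ hgγ hγ).1
        rw [UniqueFactorizationMonoid.mem_normalizedFactors_iff' he0]
        exact ⟨hπ, UniqueFactorizationMonoid.normalize_normalized_factor π hm, h9⟩
    · exact (UniqueFactorizationMonoid.squarefree_iff_nodup_normalizedFactors hg).1 hsq
  obtain ⟨t, ht⟩ := key
  refine ⟨t * p, ?_⟩
  rw [ht]
  simp only [io, map_mul] at *
  field_simp

end
end SD


namespace SD
noncomputable section
variable {k : Type*} [Field k]

/-- big field -/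
abbrev HL (k : Type*) [Field k] := HahnSeries ℤ (RatFunc k)

def dU (x : HL k) : HL k :=
  ⟨fun n => rd (x.coeff n), x.isPWO_support.mono (by
    intro n hn hx
    apply hn
    change rd (x.coeff n) = 0
    rw [hx, rd_zero])⟩

def th (x : HL k) : HL k :=
  ⟨fun n => (n : RatFunc k) * (x.coeff n), x.isPWO_support.mono (by
    intro n hn hx
    apply hn
    change (n : RatFunc k) * (x.coeff n) = 0
    rw [hx, mul_zero])⟩

lemma dU_coeff (x : HL k) (n : ℤ) : (dU x).coeff n = rd (x.coeff n) := rfl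
lemma th_coeff (x : HL k) (n : ℤ) : (th x).coeff n = (n : RatFunc k) * (x.coeff n) := rfl

lemma dU_supp (x : HL k) : (dU x).support ⊆ x.support := by
  intro n hn hx
  apply hn
  rw [dU_coeff, hx, rd_zero]

lemma th_supp (x : HL k) : (th x).support ⊆ x.support := by
  intro n hn hx
  apply hn
  rw [th_coeff, hx, mul_zero]

lemma dU_add (x y : HL k) : dU (x + y) = dU x + dU y := by
  ext n; simp [dU_coeff, rd_add]

lemma th_add (x y : HL k) : th (x + y) = th x + th y := by
  ext n; simp [th_coeff, mul_add]

lemma dU_zero : dU (0 : HL k) = 0 := by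
  ext n; simp [dU_coeff, rd_zero]

lemma th_zero : th (0 : HL k) = 0 := by
  ext n; simp [th_coeff]

lemma rd_sum {ι : Type*} (s : Finset ι) (f : ι → RatFunc k) :
    rd (∑ i ∈ s, f i) = ∑ i ∈ s, rd (f i) := map_sum (rdH (k := k)) f s

lemma dU_mul (x y : HL k) : dU (x * y) = dU x * y + x * dU y := by
  ext n
  rw [dU_coeff, HahnSeries.coeff_mul, rd_sum, HahnSeries.coeff_add,
    HahnSeries.coeff_mul_left' x.isPWO_support (dU_supp x),
    HahnSeries.coeff_mul_right' y.isPWO_support (dU_supp y), ← Finset.sum_add_distrib]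
  apply Finset.sum_congr rfl
  intro ij _
  rw [rd_mul]; rfl

lemma th_mul (x y : HL k) : th (x * y) = th x * y + x * th y := by
  ext n
  rw [th_coeff, HahnSeries.coeff_mul, Finset.mul_sum, HahnSeries.coeff_add,
    HahnSeries.coeff_mul_left' x.isPWO_support (th_supp x),
    HahnSeries.coeff_mul_right' y.isPWO_support (th_supp y), ← Finset.sum_add_distrib]
  apply Finset.sum_congr rfl
  intro ij hij
  rw [Finset.mem_antidiagonal] at hij
  rw [th_coeff, th_coeff, ← hij.2.2]
  push_cast
  ring

lemma rd_natCast (n : ℕ) : rd (n : RatFunc k) = 0 := by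
  have := rd_io (n : Polynomial k)
  simpa [io] using this

lemma rd_neg (x : RatFunc k) : rd (-x) = - rd x := map_neg (rdH (k := k)) x

lemma rd_intCast (n : ℤ) : rd (n : RatFunc k) = 0 := by
  obtain ⟨m, rfl | rfl⟩ := n.eq_nat_or_neg
  · simpa using rd_natCast m
  · push_cast
    rw [rd_neg, rd_natCast, neg_zero]

lemma th_dU (x : HL k) : th (dU x) = dU (th x) := by
  ext n
  rw [th_coeff, dU_coeff, dU_coeff, th_coeff, rd_mul, rd_intCast]
  ring

lemma coeff_mul_bot (x y : HL k) (o : ℤ) (hx : ∀ j < 0, x.coeff j = 0)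
    (hy : ∀ j < o, y.coeff j = 0) : (x * y).coeff o = x.coeff 0 * y.coeff o := by
  rw [HahnSeries.coeff_mul]
  rw [Finset.sum_eq_single (0, o)]
  · rintro ⟨i, j⟩ hij hne
    rw [Finset.mem_antidiagonal] at hij
    obtain ⟨-, -, h⟩ := hij
    simp only at h
    rcases lt_trichotomy i 0 with hi | hi | hi
    · simp [hx i hi]
    · exact absurd (Prod.ext hi (by simp; omega)) hne
    · simp [hy j (by omega)]
  · intro hn
    rw [Finset.mem_antidiagonal] at hn
    by_contra hc
    apply hn
    refine ⟨?_, ?_, by simp⟩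
    · intro h0; apply hc; simp only at h0 ⊢; rw [h0, zero_mul]
    · intro h0; apply hc; simp only at h0 ⊢; rw [h0, mul_zero]

lemma div_nonneg_order (x y : HL k) (hy : y ≠ 0) (hxy : ∀ j < y.order, (x * y).coeff j = 0) :
    ∀ j < 0, x.coeff j = 0 := by
  intro j hj
  by_cases hx : x = 0
  · simp [hx]
  apply HahnSeries.coeff_eq_zero_of_lt_order
  by_contra hlt
  have h1 : (x * y).order = x.order + y.order := HahnSeries.order_mul hx hy
  have h2 := hxy (x * y).order (by omega)
  exact HahnSeries.coeff_order_eq_zero.not.2 (mul_ne_zero hx hy) h2 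

/-- the weighted substitution -/
def Ph (p q : ℤ) : MvPolynomial (Fin 2) k →+* HL k :=
  eval₂Hom ((HahnSeries.C (Γ := ℤ) (R := RatFunc k)).comp
      ((algebraMap (Polynomial k) (RatFunc k)).comp Polynomial.C))
    ![HahnSeries.single p 1, HahnSeries.single q (io Polynomial.X)]

lemma Ph_mono (p q : ℤ) (m : Fin 2 →₀ ℕ) (c : k) :
    Ph p q (monomial m c) = HahnSeries.single (p * m 0 + q * m 1)
      (io (Polynomial.monomial (m 1) c)) := by
  unfold Ph
  rw [coe_eval₂Hom, eval₂_monomial, Finsupp.prod_fintype _ _ (by simp), Fin.prod_univ_two]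
  simp only [Matrix.cons_val_zero, Matrix.cons_val_one, HahnSeries.single_pow,
    HahnSeries.single_mul_single, RingHom.comp_apply, HahnSeries.C_apply]
  rw [← Polynomial.C_mul_X_pow_eq_monomial]
  simp only [io, map_mul, map_pow, one_pow]
  congr 1
  · simp; ring
  · ring

lemma Ph_coeff (p q : ℤ) (hp : p ≠ 0) (F : MvPolynomial (Fin 2) k) (w : ℤ) :
    ∃ g : Polynomial k, (Ph p q F).coeff w = io g ∧
      (∀ m : Fin 2 →₀ ℕ, p * m 0 + q * m 1 = w → g.coeff (m 1) = F.coeff m) ∧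
      (∀ j : ℕ, (∀ i : ℕ, p * i + q * j ≠ w) → g.coeff j = 0) := by
  induction F using MvPolynomial.induction_on' with
  | add F1 F2 h1 h2 =>
    obtain ⟨g1, a1, b1, c1⟩ := h1
    obtain ⟨g2, a2, b2, c2⟩ := h2
    refine ⟨g1 + g2, ?_, ?_, ?_⟩
    · rw [map_add, HahnSeries.coeff_add, a1, a2]; simp [io]
    · intro m hm
      rw [Polynomial.coeff_add, coeff_add, b1 m hm, b2 m hm]
    · intro j hj
      rw [Polynomial.coeff_add, c1 j hj, c2 j hj, add_zero]
  | monomial n c =>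
    rw [Ph_mono]
    by_cases hw : w = p * n 0 + q * n 1
    · refine ⟨Polynomial.monomial (n 1) c, by rw [hw, HahnSeries.coeff_single_same], ?_, ?_⟩
      · intro m hm
        rw [Polynomial.coeff_monomial, coeff_monomial]
        by_cases h : n = m
        · simp [h]
        · have : n 1 ≠ m 1 := by
            intro h1
            apply h
            rw [hw, h1] at hm
            have h0 : (m 0 : ℤ) = n 0 := mul_left_cancel₀ hp (by linarith)
            ext i
            fin_cases i
            · simp; omega
            · simpa using h1
          simp [h, this]
      · intro j hj
        rw [Polynomial.coeff_monomial]
        split_ifs with h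
        · exact absurd hw.symm (by rw [h]; exact hj (n 0))
        · rfl
    · refine ⟨0, by rw [HahnSeries.coeff_single_of_ne hw]; simp [io], ?_, by simp⟩
      intro m hm
      rw [coeff_monomial]
      split_ifs with h
      · rw [h] at hw; exact absurd hm.symm hw
      · simp

lemma dU_single (w : ℤ) (g : Polynomial k) :
    dU (HahnSeries.single w (io g)) = HahnSeries.single w (io (Polynomial.derivative g)) := by
  ext n
  rw [dU_coeff]
  by_cases h : n = w
  · rw [h, HahnSeries.coeff_single_same, HahnSeries.coeff_single_same, rd_io]
  · rw [HahnSeries.coeff_single_of_ne h, HahnSeries.coeff_single_of_ne h, rd_zero]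

lemma th_single (w : ℤ) (g : RatFunc k) :
    th (HahnSeries.single w g) = HahnSeries.single w ((w : RatFunc k) * g) := by
  ext n
  rw [th_coeff]
  by_cases h : n = w
  · rw [h, HahnSeries.coeff_single_same, HahnSeries.coeff_single_same]
  · rw [HahnSeries.coeff_single_of_ne h, HahnSeries.coeff_single_of_ne h, mul_zero]

lemma chainY (p q : ℤ) (F : MvPolynomial (Fin 2) k) :
    dU (Ph p q F) = HahnSeries.single q 1 * Ph p q (pderiv 1 F) := by
  induction F using MvPolynomial.induction_on' with
  | add F1 F2 h1 h2 => rw [map_add, dU_add, h1, h2, map_add, map_add, mul_add]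
  | monomial m c =>
    rw [pderiv_monomial, Ph_mono, Ph_mono, dU_single, HahnSeries.single_mul_single,
      Polynomial.derivative_monomial, one_mul]
    by_cases h : m 1 = 0
    · simp [h, io]
    · have h1 : (m - (Finsupp.single (1 : Fin 2) 1 : Fin 2 →₀ ℕ)) 1 = m 1 - 1 := by simp
      have h0 : (m - (Finsupp.single (1 : Fin 2) 1 : Fin 2 →₀ ℕ)) 0 = m 0 := by simp
      rw [h1, h0]
      congr 1
      obtain ⟨t, ht⟩ := Nat.exists_eq_succ_of_ne_zero h
      rw [ht]
      push_cast [Nat.succ_sub_one]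
      ring

lemma single_sub' (w : ℤ) (x y : RatFunc k) :
    (HahnSeries.single w (x - y) : HL k) = HahnSeries.single w x - HahnSeries.single w y := by
  ext n
  rw [HahnSeries.coeff_sub]
  by_cases h : n = w
  · rw [h, HahnSeries.coeff_single_same, HahnSeries.coeff_single_same,
      HahnSeries.coeff_single_same]
  · rw [HahnSeries.coeff_single_of_ne h, HahnSeries.coeff_single_of_ne h,
      HahnSeries.coeff_single_of_ne h, sub_zero]

lemma chainX (p q : ℤ) (F : MvPolynomial (Fin 2) k) :
    th (Ph p q F) - HahnSeries.single 0 ((q : RatFunc k) * io Polynomial.X) * dU (Ph p q F)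
      = HahnSeries.single p (p : RatFunc k) * Ph p q (pderiv 0 F) := by
  induction F using MvPolynomial.induction_on' with
  | add F1 F2 h1 h2 =>
    rw [map_add, dU_add, th_add, map_add, map_add, mul_add, mul_add, ← h1, ← h2]
    ring
  | monomial m c =>
    rw [pderiv_monomial, Ph_mono, Ph_mono, dU_single, th_single, HahnSeries.single_mul_single,
      HahnSeries.single_mul_single,
      Polynomial.derivative_monomial]
    have h1 : (m - (Finsupp.single (0 : Fin 2) 1 : Fin 2 →₀ ℕ)) 1 = m 1 := by simp
    have h0 : (m - (Finsupp.single (0 : Fin 2) 1 : Fin 2 →₀ ℕ)) 0 = m 0 - 1 := by simp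
    rw [h1, h0, zero_add, ← single_sub']
    have e1 : io (Polynomial.X : Polynomial k) * io (Polynomial.monomial (m 1 - 1) (c * (m 1 : k)))
        = (m 1 : RatFunc k) * io (Polynomial.monomial (m 1) c) := by
      rw [io, io, ← map_mul, Polynomial.X_mul_monomial]
      by_cases h : m 1 = 0
      · simp [h]
      · rw [Nat.sub_add_cancel (by omega), mul_comm c, ← Polynomial.C_mul_monomial, map_mul]
        simp
    have e2 : io (Polynomial.monomial (m 1) (c * (m 0 : k)))
        = (m 0 : RatFunc k) * io (Polynomial.monomial (m 1) c) := by
      rw [mul_comm c, ← Polynomial.C_mul_monomial, io, map_mul]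
      simp
    rw [mul_assoc, e1, e2]
    by_cases h : m 0 = 0
    · simp only [h]
      simp
      rw [mul_assoc, sub_self]
    · congr 1
      · obtain ⟨t, ht⟩ := Nat.exists_eq_succ_of_ne_zero h
        rw [ht]
        push_cast [Nat.succ_sub_one]
        ring
      · push_cast
        ring

end
end SD


namespace SD
noncomputable section
variable {k : Type*} [Field k]

lemma cs (w n : ℤ) (a : RatFunc k) (x : HL k) :
    (HahnSeries.single w a * x).coeff n = a * x.coeff (n - w) := by
  have := HahnSeries.coeff_single_mul_add (r := a) (x := x) (a := n - w) (b := w)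
  rwa [sub_add_cancel] at this

lemma Ph_X0 (p q : ℤ) : Ph (k := k) p q (X 0) = HahnSeries.single p 1 := by
  simp [Ph]

lemma Ph_X1 (p q : ℤ) : Ph (k := k) p q (X 1) = HahnSeries.single q (io Polynomial.X) := by
  simp [Ph]

lemma Ph_C (p q : ℤ) (c : k) : Ph (k := k) p q (C c) = HahnSeries.single 0 (io (Polynomial.C c)) := by
  simp only [Ph, coe_eval₂Hom, eval₂_C]
  rfl

/-- data extracted from a Darboux polynomial with respect to the weight `(p,q)`. -/
theorem machine (r a s b : ℕ) (c1 c2 : k) (F h : MvPolynomial (Fin 2) k) (hF : F ≠ 0)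
    (hd : X 1 ^ r * pderiv 0 F + (C c1 * X 0 ^ a * X 1 ^ s + C c2 * X 0 ^ b) * pderiv 1 F = h * F)
    (p q : ℤ) (hp : p ≠ 0) :
    ∃ (P Q H : ℤ → RatFunc k) (G : Polynomial k) (o : ℤ), G ≠ 0 ∧
      (∀ m : Fin 2 →₀ ℕ, F.coeff m ≠ 0 → o ≤ p * m 0 + q * m 1) ∧
      (∀ m : Fin 2 →₀ ℕ, p * m 0 + q * m 1 = o → G.coeff (m 1) = F.coeff m) ∧
      (∀ j : ℕ, (∀ i : ℕ, p * i + q * j ≠ o) → G.coeff j = 0) ∧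
      (∀ j < 0, P j = 0) ∧ (∀ j < 0, Q j = 0) ∧ Q 0 = (o : RatFunc k) ∧
      P 0 * io G = io (Polynomial.derivative G) ∧
      (∀ j : ℤ, (j : RatFunc k) * P j = rd (Q j)) ∧
      (∀ j : ℤ, (p : RatFunc k) * H j =
        io (Polynomial.X ^ r) * (Q (j - (q * r - p))
            - (q : RatFunc k) * io Polynomial.X * P (j - (q * r - p)))
        + (p : RatFunc k) * io (Polynomial.C c1 * Polynomial.X ^ s) * P (j - (p * a + q * s - q))
        + (p : RatFunc k) * io (Polynomial.C c2) * P (j - (p * b - q))) ∧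
      (∀ w : ℤ, ∃ g : Polynomial k, H w = io g ∧
        (∀ m : Fin 2 →₀ ℕ, p * m 0 + q * m 1 = w → g.coeff (m 1) = h.coeff m) ∧
        (∀ j : ℕ, (∀ i : ℕ, p * i + q * j ≠ w) → g.coeff j = 0)) := by
  set f := Ph p q F with hf
  have hf0 : f ≠ 0 := by
    intro h0
    apply hF
    ext m
    obtain ⟨g, h1, h2, -⟩ := Ph_coeff p q hp F (p * m 0 + q * m 1)
    rw [← hf, h0] at h1
    have : g = 0 := by
      apply io_inj
      rw [← h1]; simp [io]
    rw [← h2 m rfl, this]; simp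
  obtain ⟨G, hG1, hG2, hG3⟩ := Ph_coeff p q hp F f.order
  rw [← hf] at hG1
  have hG0 : G ≠ 0 := by
    rintro rfl
    apply HahnSeries.coeff_order_eq_zero.not.2 hf0
    rw [hG1]; simp [io]
  have hlow : ∀ j < f.order, f.coeff j = 0 := fun j hj => HahnSeries.coeff_eq_zero_of_lt_order hj
  set P := dU f / f with hP
  set Q := th f / f with hQ
  have hPf : P * f = dU f := div_mul_cancel₀ _ hf0
  have hQf : Q * f = th f := div_mul_cancel₀ _ hf0
  have hP0 : ∀ j < 0, P.coeff j = 0 := by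
    apply div_nonneg_order P f hf0
    intro j hj
    rw [hPf, dU_coeff, hlow j hj, rd_zero]
  have hQ0 : ∀ j < 0, Q.coeff j = 0 := by
    apply div_nonneg_order Q f hf0
    intro j hj
    rw [hQf, th_coeff, hlow j hj, mul_zero]
  have hPQ : th P = dU Q := by
    have h1 := congrArg th hPf
    have h2 := congrArg dU hQf
    rw [← th_dU, ← h1, th_mul, dU_mul, ← hPf, ← hQf] at h2
    apply mul_right_cancel₀ hf0
    linear_combination -h2
  refine ⟨P.coeff, Q.coeff, (Ph p q h).coeff, G, f.order, hG0, ?_, hG2, hG3, hP0, hQ0, ?_, ?_, ?_,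
    ?_, Ph_coeff p q hp h⟩
  · intro m hm
    by_contra hlt
    obtain ⟨g, h1, h2, -⟩ := Ph_coeff p q hp F (p * m 0 + q * m 1)
    rw [← hf, hlow _ (not_le.1 hlt)] at h1
    have : g = 0 := by
      apply io_inj
      rw [← h1]; simp [io]
    apply hm
    rw [← h2 m rfl, this]; simp
  · have h1 := coeff_mul_bot Q f f.order hQ0 hlow
    rw [hQf, th_coeff] at h1
    exact (mul_right_cancel₀ (HahnSeries.coeff_order_eq_zero.not.2 hf0) h1).symm
  · have h1 := coeff_mul_bot P f f.order hP0 hlow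
    rw [hPf, dU_coeff, hG1, rd_io] at h1
    exact h1.symm
  · intro j
    rw [← th_coeff, hPQ, dU_coeff]
  · have hY := chainY p q F
    have hX := chainX p q F
    rw [← hf, ← hPf] at hY
    rw [← hf, ← hPf, ← hQf] at hX
    have hY' : Ph p q (pderiv 1 F) = HahnSeries.single (-q) 1 * P * f := by
      have : HahnSeries.single (-q) (1 : RatFunc k) * HahnSeries.single q (1 : RatFunc k) = 1 := by
        rw [HahnSeries.single_mul_single]; simp
      rw [mul_assoc, hY, ← mul_assoc, this, one_mul]
    have hX' : HahnSeries.single 0 (p : RatFunc k) * Ph p q (pderiv 0 F) = HahnSeries.single (-p) 1 *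
        (Q - HahnSeries.single 0 ((q : RatFunc k) * io Polynomial.X) * P) * f := by
      have : HahnSeries.single (-p) (1 : RatFunc k) * HahnSeries.single p (p : RatFunc k)
          = HahnSeries.single 0 (p : RatFunc k) := by
        rw [HahnSeries.single_mul_single]; simp
      rw [← this, mul_assoc _ (HahnSeries.single p _), ← hX]
      ring
    have h1 := congrArg (Ph p q) hd
    simp only [map_add, map_mul, map_pow, Ph_X0, Ph_X1, Ph_C, HahnSeries.single_pow,
      HahnSeries.single_mul_single] at h1
    rw [hY', ← hf] at h1
    have h2 : HahnSeries.single 0 (p : RatFunc k) * Ph p q h =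
        HahnSeries.single (q * r - p) (io (Polynomial.X ^ r)) * (Q - HahnSeries.single 0
          ((q : RatFunc k) * io Polynomial.X) * P)
        + HahnSeries.single (p * a + q * s - q) ((p : RatFunc k) *
            io (Polynomial.C c1 * Polynomial.X ^ s)) * P
        + HahnSeries.single (p * b - q) ((p : RatFunc k) * io (Polynomial.C c2)) * P := by
      apply mul_right_cancel₀ hf0
      have e1 : HahnSeries.single (q * r - p) (io ((Polynomial.X : Polynomial k) ^ r))
          = HahnSeries.single (r • q) (io Polynomial.X ^ r) * HahnSeries.single (-p) (1 : RatFunc k) := by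
        rw [HahnSeries.single_mul_single]
        congr 1
        · simp; ring
        · simp [io]
      have e2 : HahnSeries.single (p * a + q * s - q) ((p : RatFunc k) *
            io (Polynomial.C c1 * Polynomial.X ^ s))
          = HahnSeries.single 0 (p : RatFunc k) * HahnSeries.single (0 + a • p + s • q)
            (io (Polynomial.C c1) * 1 ^ a * io Polynomial.X ^ s)
            * HahnSeries.single (-q) (1 : RatFunc k) := by
        rw [HahnSeries.single_mul_single, HahnSeries.single_mul_single]
        congr 1
        · simp; ring
        · simp [io]
      have e3 : HahnSeries.single (p * b - q) ((p : RatFunc k) * io (Polynomial.C c2))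
          = HahnSeries.single 0 (p : RatFunc k) * HahnSeries.single (0 + b • p)
            (io (Polynomial.C c2) * 1 ^ b)
            * HahnSeries.single (-q) (1 : RatFunc k) := by
        rw [HahnSeries.single_mul_single, HahnSeries.single_mul_single]
        congr 1
        · simp; ring
        · simp [io]
      rw [e1, e2, e3]
      linear_combination -(HahnSeries.single 0 (p : RatFunc k)) * h1
        + (HahnSeries.single (r • q) (io Polynomial.X ^ r)) * hX'
    intro j
    have h3 := congrArg (fun x : HL k => x.coeff j) h2
    simp only [HahnSeries.coeff_add, cs, HahnSeries.coeff_sub, sub_zero] at h3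
    exact h3

end
end SD


namespace SD
noncomputable section
variable {k : Type*} [Field k]

lemma coeff_zero_ne [CharZero k] {G Hm e : Polynomial k} (hG : G ≠ 0) (he : e.coeff 0 ≠ 0)
    (h : Hm * G = e * Polynomial.derivative G) : G.coeff 0 ≠ 0 := by
  intro h0
  obtain ⟨n, G1, hG1, hn⟩ := WfDvdMonoid.max_power_factor hG Polynomial.irreducible_X
  cases n with
  | zero =>
    apply hG1
    rw [pow_zero, one_mul] at hn
    rw [← hn, Polynomial.X_dvd_iff, h0]
  | succ n =>
    have h1 : Polynomial.X ^ n * (Polynomial.X * (Hm * G1 - e * Polynomial.derivative G1)) =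
        Polynomial.X ^ n * (e * (Polynomial.C ((n : k) + 1) * G1)) := by
      rw [hn] at h
      simp only [Polynomial.derivative_mul, Polynomial.derivative_X_pow] at h
      push_cast at h
      simp only [Nat.add_sub_cancel, map_add, map_one] at h ⊢
      linear_combination h
    have h2 := mul_left_cancel₀ (pow_ne_zero _ Polynomial.X_ne_zero) h1
    have h3 : (Polynomial.X : Polynomial k) ∣ e * (Polynomial.C ((n : k) + 1) * G1) := ⟨_, h2.symm⟩
    rcases Polynomial.prime_X.dvd_or_dvd h3 with h4 | h4
    · exact he (Polynomial.X_dvd_iff.1 h4)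
    · rcases Polynomial.prime_X.dvd_or_dvd h4 with h4 | h4
      · rw [Polynomial.X_dvd_iff] at h4
        simp at h4
        exact Nat.cast_add_one_ne_zero n h4
      · exact hG1 h4

lemma poly_top [CharZero k] {G Hm e : Polynomial k} (hG : G ≠ 0) (c1 : k) (hc1 : c1 ≠ 0) (s : ℕ)
    (hs : 1 ≤ s) (hes : e.natDegree = s) (hel : e.coeff s = c1)
    (h : Hm * G = e * Polynomial.derivative G) :
    Hm.natDegree ≤ s - 1 ∧ Hm.coeff (s - 1) = c1 * G.natDegree := by
  by_cases hn : G.natDegree = 0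
  · rw [Polynomial.derivative_of_natDegree_zero hn, mul_zero] at h
    have : Hm = 0 := (mul_eq_zero.1 h).resolve_right hG
    simp [this, hn]
  have hd : Polynomial.derivative G ≠ 0 := by
    intro h0
    exact hn (Polynomial.derivative_eq_zero.1 h0)
  have he0 : e ≠ 0 := by rintro rfl; simp at hes; omega
  have hdeg : (Polynomial.derivative G).natDegree = G.natDegree - 1 :=
    Polynomial.natDegree_derivative G
  have hH : Hm ≠ 0 := by
    rintro rfl
    rw [zero_mul] at h
    exact (mul_ne_zero he0 hd) h.symm
  have h1 := congrArg Polynomial.natDegree h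
  rw [Polynomial.natDegree_mul hH hG, Polynomial.natDegree_mul he0 hd, hdeg, hes] at h1
  have h2 : Hm.natDegree = s - 1 := by omega
  refine ⟨h2.le, ?_⟩
  have h3 := congrArg Polynomial.leadingCoeff h
  rw [Polynomial.leadingCoeff_mul, Polynomial.leadingCoeff_mul] at h3
  simp only [Polynomial.leadingCoeff] at h3
  rw [h2, hes, hel, hdeg, Polynomial.coeff_derivative] at h3
  have h4 : G.natDegree - 1 + 1 = G.natDegree := by omega
  rw [h4] at h3
  have h5 : ((G.natDegree - 1 : ℕ) : k) + 1 = G.natDegree := by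
    exact_mod_cast congrArg (Nat.cast (R := k)) h4
  rw [h5] at h3
  apply mul_right_cancel₀ (Polynomial.leadingCoeff_ne_zero.2 hG)
  simp only [Polynomial.leadingCoeff]
  linear_combination h3

lemma e_facts (c1 c2 : k) (hc1 : c1 ≠ 0) (s : ℕ) (hs : 1 ≤ s) :
    (Polynomial.C c1 * Polynomial.X ^ s + Polynomial.C c2).natDegree = s ∧
    (Polynomial.C c1 * Polynomial.X ^ s + Polynomial.C c2).coeff s = c1 ∧
    (Polynomial.C c1 * Polynomial.X ^ s + Polynomial.C c2).coeff 0 = c2 := by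
  refine ⟨?_, ?_, ?_⟩
  · rw [Polynomial.natDegree_add_C, Polynomial.natDegree_C_mul_X_pow _ _ hc1]
  · simp [Polynomial.coeff_C, show s ≠ 0 by omega]
  · simp [Polynomial.coeff_X_pow, show ¬ 0 = s by omega]

lemma e_sqf [CharZero k] (c1 c2 : k) (hc1 : c1 ≠ 0) (hc2 : c2 ≠ 0) (s : ℕ) (hs : 1 ≤ s) :
    Squarefree (Polynomial.C c1 * Polynomial.X ^ s + Polynomial.C c2) := by
  apply Polynomial.Separable.squarefree
  rw [Polynomial.Separable]
  refine ⟨Polynomial.C c2⁻¹, - Polynomial.C (c2⁻¹ * (s : k)⁻¹) * Polynomial.X, ?_⟩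
  simp only [Polynomial.derivative_add, Polynomial.derivative_C_mul, Polynomial.derivative_X_pow,
    Polynomial.derivative_C]
  obtain ⟨t, rfl⟩ : ∃ t, s = t + 1 := ⟨s - 1, by omega⟩
  have hs0 : ((t + 1 : ℕ) : k) ≠ 0 := Nat.cast_ne_zero.2 (by omega)
  have h1 : Polynomial.C (c2⁻¹) * Polynomial.C c2 = 1 := by
    rw [← Polynomial.C_mul, inv_mul_cancel₀ hc2, Polynomial.C_1]
  have h2 : Polynomial.C (((t + 1 : ℕ) : k)⁻¹) * Polynomial.C (((t + 1 : ℕ) : k)) = 1 := by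
    rw [← Polynomial.C_mul, inv_mul_cancel₀ hs0, Polynomial.C_1]
  rw [Polynomial.C_mul]
  simp only [Nat.add_sub_cancel]
  linear_combination h1 - Polynomial.C c2⁻¹ * Polynomial.C c1 * Polynomial.X ^ (t + 1) * h2

/-- the divisibility relation -/
lemma poly_div [CharZero k] (c1 c2 : k) (hc1 : c1 ≠ 0) (hc2 : c2 ≠ 0) (s : ℕ) (hs : 1 ≤ s)
    (A B : Polynomial k) (R : RatFunc k)
    (h : io (Polynomial.C c1 * Polynomial.X ^ s + Polynomial.C c2) ^ 2 * rd R =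
      io (A * (Polynomial.C c1 * Polynomial.X ^ s + Polynomial.C c2) + B)) :
    (Polynomial.C c1 * Polynomial.X ^ s + Polynomial.C c2) ∣
      - Polynomial.C (s * c2) * A + Polynomial.X * Polynomial.derivative B
        - Polynomial.C ((s : k) - 1) * B := by
  have hsq := e_sqf c1 c2 hc1 hc2 s hs
  have hef := e_facts c1 c2 hc1 s hs
  set e := (Polynomial.C c1 * Polynomial.X ^ s + Polynomial.C c2) with he
  have he0 : e ≠ 0 := by intro h0; rw [h0] at hef; apply hc2; rw [← hef.2.2]; simp
  obtain ⟨N, hN⟩ := rat_lemma hsq he0 R h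
  have h1 := congrArg rd hN
  rw [rd_mul, rd_io, rd_io] at h1
  have h2 : e * Polynomial.derivative N - N * Polynomial.derivative e = A * e + B := by
    apply io_inj
    rw [← h]
    simp only [io, map_sub, map_mul] at *
    linear_combination - algebraMap (Polynomial k) (RatFunc k) e * h1
      + (algebraMap (Polynomial k) (RatFunc k) (Polynomial.derivative e)) * hN
  have h3 := congrArg Polynomial.derivative h2
  simp only [Polynomial.derivative_sub, Polynomial.derivative_mul, Polynomial.derivative_add] at h3
  have h4 : Polynomial.X * Polynomial.derivative e = Polynomial.C (s : k) * (e - Polynomial.C c2) := by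
    obtain ⟨t, rfl⟩ : ∃ t, s = t + 1 := ⟨s - 1, by omega⟩
    rw [he]
    simp only [Polynomial.derivative_add, Polynomial.derivative_C_mul, Polynomial.derivative_X_pow,
      Polynomial.derivative_C, Nat.add_sub_cancel]
    ring
  have h5 := congrArg Polynomial.derivative h4
  simp only [Polynomial.derivative_sub, Polynomial.derivative_mul, Polynomial.derivative_X,
    Polynomial.derivative_C] at h5
  simp only [Polynomial.C_mul, Polynomial.C_sub, Polynomial.C_1]
  set e' := Polynomial.derivative e
  set e'' := Polynomial.derivative e'
  set N' := Polynomial.derivative N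
  set N'' := Polynomial.derivative N'
  refine ⟨Polynomial.X * N'' - Polynomial.X * Polynomial.derivative A
    - Polynomial.C (s : k) * A - (Polynomial.C (s : k) - 1) * N' + (Polynomial.C (s : k) - 1) * A, ?_⟩
  linear_combination -Polynomial.X * h3 + (Polynomial.C (s : k) - 1) * h2 - N * h5 - A * h4

lemma poly_coeffs [CharZero k] (c1 c2 : k) (hc1 : c1 ≠ 0) (hc2 : c2 ≠ 0) (s r : ℕ) (hs : 1 ≤ s)
    (W : Polynomial k) (hW : W.natDegree ≤ r + s) (hlow : ∀ j < r, W.coeff j = 0)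
    (hdv : (Polynomial.C c1 * Polynomial.X ^ s + Polynomial.C c2) ∣ W) :
    c1 * W.coeff r = c2 * W.coeff (r + s) := by
  obtain ⟨T, rfl⟩ := hdv
  have hef := e_facts c1 c2 hc1 s hs
  have hT : T.natDegree ≤ r := by
    by_cases hT0 : T = 0
    · simp [hT0]
    rw [Polynomial.natDegree_mul (by intro h0; rw [h0] at hef; apply hc2; rw [← hef.2.2]; simp) hT0,
      hef.1] at hW
    omega
  have hco : ∀ j, ((Polynomial.C c1 * Polynomial.X ^ s + Polynomial.C c2) * T).coeff j =
      c1 * (if s ≤ j then T.coeff (j - s) else 0) + c2 * T.coeff j := by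
    intro j
    rw [add_mul, Polynomial.coeff_add, Polynomial.coeff_C_mul, mul_assoc, Polynomial.coeff_C_mul,
      Polynomial.coeff_X_pow_mul']
  have hTl : ∀ j < r, T.coeff j = 0 := by
    intro j
    induction j using Nat.strong_induction_on with
    | _ j ih =>
      intro hj
      have h1 := hlow j hj
      rw [hco] at h1
      have h2 : (if s ≤ j then T.coeff (j - s) else 0) = 0 := by
        split_ifs with h
        · exact ih _ (by omega) (by omega)
        · rfl
      rw [h2, mul_zero, zero_add] at h1
      exact (mul_eq_zero.1 h1).resolve_left hc2
  rw [hco, hco]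
  have h2 : (if s ≤ r then T.coeff (r - s) else 0) = 0 := by
    split_ifs with h
    · exact hTl _ (by omega)
    · rfl
  have h3 : T.coeff (r + s) = 0 := Polynomial.coeff_eq_zero_of_natDegree_lt (by omega)
  rw [h2, h3]
  simp
  ring

end
end SD


namespace SD
noncomputable section
variable {k : Type*} [Field k]

lemma io_intCast (n : ℤ) : (n : RatFunc k) = io (Polynomial.C (n : k)) := by
  simp [io]

theorem first [CharZero k] (r a s b : ℕ) (c1 c2 : k) (hc1 : c1 ≠ 0) (hc2 : c2 ≠ 0) (hs : 1 ≤ s)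
    (hab : b < a ∨ (r = 0 ∧ a < b))
    (F h : MvPolynomial (Fin 2) k) (hF : F ≠ 0)
    (hd : X 1 ^ r * pderiv 0 F + (C c1 * X 0 ^ a * X 1 ^ s + C c2 * X 0 ^ b) * pderiv 1 F = h * F)
    (hh : ∀ m, h.coeff m ≠ 0 → m 1 < r + s) :
    ∃ (G : Polynomial k) (o : ℤ), G.coeff 0 ≠ 0 ∧
      (∀ m : Fin 2 →₀ ℕ, F.coeff m ≠ 0 → o ≤ -s * m 0 + (a - b) * m 1) ∧
      (∀ m : Fin 2 →₀ ℕ, -s * m 0 + (a - b) * m 1 = o → G.coeff (m 1) = F.coeff m) ∧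
      (∀ j : ℕ, (∀ i : ℕ, -s * i + ((a : ℤ) - b) * j ≠ o) → G.coeff j = 0) ∧
      s * o = (r + 1) * (a - b) * G.natDegree := by
  have hp : (-(s : ℤ)) ≠ 0 := by omega
  obtain ⟨P, Q, H, G, o, hG, h1, h2, h3, hP, hQ, hQ0, hPG, hPQ, hEq, hHc⟩ :=
    machine r a s b c1 c2 F h hF hd (-(s : ℤ)) ((a : ℤ) - b) hp
  set q : ℤ := (a : ℤ) - b with hq
  set m : ℤ := -(s : ℤ) * a + q * s - q with hm
  have hm2 : -(s : ℤ) * b - q = m := by rw [hm, hq]; ring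
  set M : ℤ := q * r - (-(s : ℤ)) - m with hM
  have hMpos : 0 < M := by
    have : M = s * (b + 1) + (r + 1) * (a - b) := by rw [hM, hm, hq]; ring
    rw [this]
    rcases hab with h | ⟨rfl, h⟩
    · have : (0 : ℤ) < a - b := by omega
      positivity
    · have : (1 : ℤ) * (b + 1) ≤ s * (b + 1) := by
        apply mul_le_mul_of_nonneg_right <;> omega
      push_cast
      linarith
  set e := (Polynomial.C c1 * Polynomial.X ^ s + Polynomial.C c2) with he
  have hef := e_facts c1 c2 hc1 s hs
  rw [← he] at hef
  obtain ⟨Hm, hHm, -, -⟩ := hHc m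
  obtain ⟨H0, hH0, hH0a, hH0b⟩ := hHc (q * r - (-(s : ℤ)))
  have hsR : (((-(s : ℤ)) : ℤ) : RatFunc k) ≠ 0 := by
    rw [io_intCast]; apply io_ne
    rw [Ne, Polynomial.C_eq_zero]
    exact_mod_cast hp
  -- degree m equation
  have hE1 : io Hm = io e * P 0 := by
    have := hEq m
    rw [hm2, sub_self, hHm, hP _ (by omega), hQ _ (by omega)] at this
    apply mul_left_cancel₀ hsR
    rw [this, he]
    simp only [io, map_add]
    ring
  have hHG : Hm * G = e * Polynomial.derivative G := by
    apply io_inj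
    have : io Hm * io G = io e * io (Polynomial.derivative G) := by
      rw [hE1, ← hPG]; ring
    simpa [io] using this
  have hG0 : G.coeff 0 ≠ 0 := coeff_zero_ne hG (by rw [hef.2.2]; exact hc2) hHG
  obtain ⟨hHd, hHt⟩ := poly_top hG c1 hc1 s hs hef.1 hef.2.1 hHG
  refine ⟨G, o, hG0, h1, h2, h3, ?_⟩
  -- degree m0 equation
  have hE2 : (((-(s : ℤ)) : ℤ) : RatFunc k) * io H0 = io (Polynomial.X ^ r) * ((o : RatFunc k) -
      (q : RatFunc k) * io Polynomial.X * P 0) + (((-(s : ℤ)) : ℤ) : RatFunc k) * io e * P M := by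
    have := hEq (q * r - (-(s : ℤ)))
    rw [hm2, sub_self, hH0, hQ0, ← hM] at this
    rw [this, he]
    simp only [io, map_add]
    ring
  have hMk : (M : k) ≠ 0 := by exact_mod_cast hMpos.ne'
  set R : RatFunc k := io (Polynomial.C ((-(s : ℤ) : ℤ) / (M : k))) * Q M with hR
  have hrd : rd R = (((-(s : ℤ)) : ℤ) : RatFunc k) * P M := by
    rw [hR, rd_mul, rd_io, ← hPQ M, io_intCast M, io_intCast (-(s : ℤ))]
    have : (Polynomial.C ((-(s : ℤ) : ℤ) / (M : k))) * Polynomial.C (M : k)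
        = Polynomial.C ((-(s : ℤ) : ℤ) : k) := by
      rw [← Polynomial.C_mul, div_mul_cancel₀ _ hMk]
    rw [← this]
    simp only [io, map_mul, Polynomial.derivative_C, map_zero]
    ring
  set A : Polynomial k := Polynomial.C ((-(s : ℤ) : ℤ) : k) * H0 - Polynomial.C (o : k) * Polynomial.X ^ r
    with hA
  set B : Polynomial k := Polynomial.C (q : k) * (Polynomial.X ^ (r + 1) * Hm) with hB
  have hfin := poly_div c1 c2 hc1 hc2 s hs A B R (by
    rw [← he, hrd, hA, hB]
    rw [io_intCast, io_intCast, io_intCast] at hE2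
    rw [io_intCast]
    simp only [io, map_add, map_sub, map_mul, map_pow] at *
    linear_combination - algebraMap (Polynomial k) (RatFunc k) e * hE2
      - algebraMap (Polynomial k) (RatFunc k) (Polynomial.C (q : k)) *
        algebraMap (Polynomial k) (RatFunc k) Polynomial.X ^ (r + 1) * hE1)
  set W := - Polynomial.C (s * c2) * A + Polynomial.X * Polynomial.derivative B
        - Polynomial.C ((s : k) - 1) * B with hW
  have hWe : W = Polynomial.C (s * c2 * s) * H0 + Polynomial.C (s * c2 * o) * Polynomial.X ^ r
      + Polynomial.X ^ (r + 1) * (Polynomial.C (q : k) * (Polynomial.C ((r : k) + 2 - s) * Hm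
        + Polynomial.X * Polynomial.derivative Hm)) := by
    rw [hW, hA, hB]
    simp only [Polynomial.derivative_mul, Polynomial.derivative_X_pow, Polynomial.derivative_C,
      Nat.add_sub_cancel, Polynomial.C_add, Polynomial.C_mul, Polynomial.C_sub, Polynomial.C_1,
      Int.cast_neg, Int.cast_natCast, Polynomial.C_neg, Nat.cast_add, Nat.cast_one]
    have : (Polynomial.C 2 : Polynomial k) = 2 := rfl
    rw [this]
    ring
  have hH0low : ∀ j ≤ r, H0.coeff j = 0 := by
    intro j hj
    apply hH0b
    intro i hi
    have h5 : q * ((j : ℤ) - r) = s * (i + 1) := by linarith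
    have h6 : 0 < q * ((j : ℤ) - r) := by
      rw [h5]
      have : (0 : ℤ) < s := by omega
      positivity
    rcases hab with h | ⟨rfl, h⟩
    · have : 0 < q := by omega
      have := (pos_iff_pos_of_mul_pos h6).1 this
      omega
    · have hj0 : j = 0 := by omega
      rw [hj0] at h6
      simp at h6
  have hH0deg : ∀ j, r + s ≤ j → H0.coeff j = 0 := by
    intro j hj
    by_cases hex : ∃ i : ℕ, -(s : ℤ) * i + q * j = q * r - (-(s : ℤ))
    · obtain ⟨i, hi⟩ := hex
      have := hH0a (Finsupp.single 0 i + Finsupp.single 1 j) (by simpa using hi)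
      simp at this
      rw [this]
      by_contra hne
      have := hh _ hne
      simp at this
      omega
    · push Not at hex
      exact hH0b j hex
  set K := (Polynomial.C (q : k) * (Polynomial.C ((r : k) + 2 - s) * Hm
        + Polynomial.X * Polynomial.derivative Hm)) with hK
  have hKc : ∀ j, K.coeff j = q * (((r : k) + 2 - s + j) * Hm.coeff j) := by
    intro j
    rw [hK, Polynomial.coeff_C_mul, Polynomial.coeff_add, Polynomial.coeff_C_mul]
    cases j with
    | zero => simp
    | succ j => rw [Polynomial.coeff_X_mul, Polynomial.coeff_derivative]; push_cast; ring
  have hfinal := poly_coeffs c1 c2 hc1 hc2 s r hs W (by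
    rw [Polynomial.natDegree_le_iff_coeff_eq_zero]
    intro j hj
    have e1 := hH0deg j (by omega)
    have e2 : K.coeff (j - (r + 1)) = 0 := by
      rw [hKc, Polynomial.coeff_eq_zero_of_natDegree_lt (p := Hm) (by omega)]; simp
    rw [hWe]
    simp only [Polynomial.coeff_add, Polynomial.coeff_C_mul, Polynomial.coeff_X_pow,
      Polynomial.coeff_X_pow_mul', e1, e2]
    simp
    intro hjr
    omega) (by
    intro j hj
    rw [hWe]
    simp only [Polynomial.coeff_add, Polynomial.coeff_C_mul, Polynomial.coeff_X_pow,
      Polynomial.coeff_X_pow_mul', hH0low j hj.le]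
    rw [if_neg (by omega), if_neg (by omega)]
    simp) hfin
  have w1 : W.coeff r = s * c2 * o := by
    rw [hWe]
    simp only [Polynomial.coeff_add, Polynomial.coeff_C_mul, Polynomial.coeff_X_pow,
      Polynomial.coeff_X_pow_mul', hH0low r le_rfl]
    rw [if_neg (show ¬ r + 1 ≤ r by omega)]
    simp
  have w2 : W.coeff (r + s) = q * ((r + 1) * (c1 * G.natDegree)) := by
    rw [hWe]
    simp only [Polynomial.coeff_add, Polynomial.coeff_C_mul, Polynomial.coeff_X_pow,
      Polynomial.coeff_X_pow_mul', hH0deg (r + s) le_rfl]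
    rw [if_neg (show ¬ r + s = r by omega), if_pos (by omega), show r + s - (r + 1) = s - 1 by omega, hKc, hHt]
    rw [Nat.cast_sub hs]
    push_cast
    ring
  rw [w1, w2] at hfinal
  have h9 : (s : k) * o = (r + 1) * q * G.natDegree := by
    apply mul_left_cancel₀ (mul_ne_zero hc1 hc2)
    linear_combination hfinal
  exact_mod_cast h9

end
end SD


namespace SD
noncomputable section
variable {k : Type*} [Field k]

lemma ext2 {m n : Fin 2 →₀ ℕ} (h0 : m 0 = n 0) (h1 : m 1 = n 1) : m = n := by
  ext i
  fin_cases i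
  · exact h0
  · exact h1

lemma first_ends {G : Polynomial k} {o p q : ℤ} (hG0 : G.coeff 0 ≠ 0)
    (h3 : ∀ j : ℕ, (∀ i : ℕ, p * i + q * j ≠ o) → G.coeff j = 0) :
    (∃ i : ℕ, p * i = o) ∧ ∃ i : ℕ, p * i + q * G.natDegree = o := by
  constructor
  · by_contra hc
    push Not at hc
    exact hG0 (h3 0 (by simpa using hc))
  · by_contra hc
    push Not at hc
    have := h3 G.natDegree hc
    have hG : G ≠ 0 := by rintro rfl; simp at hG0
    exact Polynomial.leadingCoeff_ne_zero.2 hG this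

theorem case_lt [CharZero k] (a s b : ℕ) (c1 c2 : k) (hc1 : c1 ≠ 0) (hc2 : c2 ≠ 0) (hs : 2 ≤ s)
    (hab : a < b) (F h : MvPolynomial (Fin 2) k) (hF : F ≠ 0)
    (hd : X 1 ^ 0 * pderiv 0 F + (C c1 * X 0 ^ a * X 1 ^ s + C c2 * X 0 ^ b) * pderiv 1 F = h * F)
    (hh : ∀ m, h.coeff m ≠ 0 → m 1 < 0 + s) : ∀ m, F.coeff m ≠ 0 → m = 0 := by
  obtain ⟨G, o, hG0, h1, h2, h3, h4⟩ :=
    first 0 a s b c1 c2 hc1 hc2 (by omega) (Or.inr ⟨rfl, hab⟩) F h hF hd hh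
  obtain ⟨⟨i0, hi0⟩, ⟨i1, hi1⟩⟩ := first_ends hG0 h3
  have ho : o = 0 := by
    have h5 : ((s : ℤ) - 1) * o = s * i1 := by
      push_cast at h4
      linarith
    have h6 : (0 : ℤ) ≤ s * i1 := by positivity
    have h7 : (0 : ℤ) ≤ s * i0 := by positivity
    have h8 : o ≤ 0 := by linarith
    by_contra hne
    have h9 : o < 0 := by omega
    have : ((s : ℤ) - 1) * o < 0 := mul_neg_of_pos_of_neg (by omega) h9
    omega
  intro m hm
  have h5 := h1 m hm
  rw [ho] at h5
  have h6 : (0 : ℤ) < b - a := by omega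
  have h7 : (0 : ℤ) ≤ s * m 0 := by positivity
  have h8 : (0 : ℤ) ≤ (b - a) * m 1 := by positivity
  have h9 : (s : ℤ) * m 0 = 0 := by linarith
  have h10 : ((b : ℤ) - a) * m 1 = 0 := by linarith
  have h11 := (mul_eq_zero.1 h9).resolve_left (by omega)
  have h12 := (mul_eq_zero.1 h10).resolve_left (by omega)
  exact ext2 (by simpa using h11) (by simpa using h12)

theorem case_gt [CharZero k] (r a s b : ℕ) (c1 c2 : k) (hc1 : c1 ≠ 0) (hc2 : c2 ≠ 0) (hs : 1 ≤ s)
    (hab : b < a) (F h : MvPolynomial (Fin 2) k) (hF : F ≠ 0)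
    (hd : X 1 ^ r * pderiv 0 F + (C c1 * X 0 ^ a * X 1 ^ s + C c2 * X 0 ^ b) * pderiv 1 F = h * F)
    (hh : ∀ m, h.coeff m ≠ 0 → m 1 < r + s) : ∀ m, F.coeff m ≠ 0 → m = 0 := by
  have hq : (0 : ℤ) < a - b := by omega
  have hsp : (0 : ℤ) < s := by omega
  have hkey : F.coeff 0 ≠ 0 ∧ ∀ m, F.coeff m ≠ 0 → m ≠ 0 → (s : ℤ) * m 0 < (a - b) * m 1 := by
    obtain ⟨G, o, hG0, h1, h2, h3, h4⟩ :=
      first r a s b c1 c2 hc1 hc2 hs (Or.inl hab) F h hF hd hh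
    obtain ⟨⟨i0, hi0⟩, ⟨i1, hi1⟩⟩ := first_ends hG0 h3
    have h5 : (0 : ℤ) ≤ (r + 1) * (a - b) * G.natDegree := by positivity
    have ho : o = 0 := by
      have h6 : (0 : ℤ) ≤ s * i0 := by positivity
      have h8 : o ≤ 0 := by linarith
      by_contra hne
      have h9 : o < 0 := by omega
      have : (s : ℤ) * o < 0 := mul_neg_of_pos_of_neg (by omega) h9
      omega
    subst ho
    have hn : G.natDegree = 0 := by
      rw [mul_zero] at h4
      have := (mul_eq_zero.1 h4.symm).resolve_left (by positivity)
      omega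
    refine ⟨?_, ?_⟩
    · rw [← h2 0 (by simp)]; exact hG0
    · intro m hm hm0
      have h6 := h1 m hm
      rcases h6.lt_or_eq with h7 | h7
      · linarith
      · exfalso
        have h8 := h2 m h7.symm
        have h9 : m 1 = 0 := by
          by_contra hne
          apply hm
          rw [← h8]
          apply Polynomial.coeff_eq_zero_of_natDegree_lt
          omega
        apply hm0
        apply ext2 _ h9
        rw [h9] at h7
        have : (s : ℤ) * m 0 = 0 := by push_cast at h7; linarith
        have := (mul_eq_zero.1 this).resolve_left (by omega)
        simpa using this
  obtain ⟨hF0, hlt⟩ := hkey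
  by_contra hcon
  push Not at hcon
  obtain ⟨mm, hmm, hmm0⟩ := hcon
  have hne : (F.support.erase 0).Nonempty := ⟨mm, by
    rw [Finset.mem_erase, mem_support_iff]; exact ⟨hmm0, hmm⟩⟩
  obtain ⟨n, hn, hmax⟩ := Finset.exists_max_image (F.support.erase 0)
    (fun m => (m 0 : ℚ) / (m 1 : ℚ)) hne
  have hpos : ∀ m ∈ F.support.erase 0, 0 < m 1 := by
    intro m hm
    rw [Finset.mem_erase, mem_support_iff] at hm
    have h5 := hlt m hm.2 hm.1
    have h6 : (0 : ℤ) ≤ s * m 0 := by positivity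
    have h7 : (0 : ℤ) < (a - b) * m 1 := by linarith
    have := (pos_iff_pos_of_mul_pos h7).1 hq
    omega
  have hn1 := hpos n hn
  have hnF : F.coeff n ≠ 0 := by
    rw [Finset.mem_erase, mem_support_iff] at hn; exact hn.2
  have hn0 : n ≠ 0 := by
    rw [Finset.mem_erase, mem_support_iff] at hn; exact hn.1
  have hmin : ∀ m, F.coeff m ≠ 0 → (0 : ℤ) ≤ -(n 1 : ℤ) * m 0 + n 0 * m 1 := by
    intro m hm
    by_cases hm0 : m = 0
    · simp [hm0]
    have hm' : m ∈ F.support.erase 0 := by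
      rw [Finset.mem_erase, mem_support_iff]; exact ⟨hm0, hm⟩
    have h5 := hmax m hm'
    have h6 := hpos m hm'
    rw [div_le_div_iff₀ (by exact_mod_cast h6) (by exact_mod_cast hn1)] at h5
    have h7 : (m 0 : ℤ) * n 1 ≤ n 0 * m 1 := by exact_mod_cast h5
    linarith
  have hp : (-(n 1 : ℤ)) ≠ 0 := by omega
  obtain ⟨P, Q, H, G, o, hG, h1, h2, h3, hP, hQ, hQ0, hPG, hPQ, hEq, hHc⟩ :=
    machine r a s b c1 c2 F h hF hd (-(n 1 : ℤ)) (n 0 : ℤ) hp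
  have ho : o = 0 := by
    apply le_antisymm
    · simpa using h1 0 hF0
    · have hl := Polynomial.leadingCoeff_ne_zero.2 hG
      have : ∃ i : ℕ, -(n 1 : ℤ) * i + n 0 * G.natDegree = o := by
        by_contra hc
        push Not at hc
        exact hl (h3 _ hc)
      obtain ⟨i, hi⟩ := this
      have h5 := h2 (Finsupp.single 0 i + Finsupp.single 1 G.natDegree) (by simpa using hi)
      have h6 := hmin (Finsupp.single 0 i + Finsupp.single 1 G.natDegree) (by
        rw [← h5]; simpa using hl)
      rw [← hi]
      simpa using h6
  subst ho
  have hG0 : G.coeff 0 ≠ 0 := by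
    have := h2 0 (by simp)
    simp only [Finsupp.coe_zero, Pi.zero_apply] at this
    rw [this]; exact hF0
  have hGn : G.coeff (n 1) ≠ 0 := by
    rw [h2 n (by ring)]; exact hnF
  have hdeg : G.natDegree ≠ 0 := by
    have := Polynomial.le_natDegree_of_ne_zero hGn
    omega
  have hnlt := hlt n hnF hn0
  set m1 : ℤ := -(n 1 : ℤ) * a + n 0 * s - n 0 with hm1
  obtain ⟨Hm, hHm, -, -⟩ := hHc m1
  have hx : m1 < -(n 1 : ℤ) * b - n 0 := by rw [hm1]; linarith
  have hy : m1 < n 0 * r - -(n 1 : ℤ) := by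
    have e1 : (0 : ℤ) ≤ n 1 * b := by positivity
    have e2 : (0 : ℤ) ≤ n 0 * r := by positivity
    linarith
  have hR : ((-(n 1 : ℤ) : ℤ) : RatFunc k) ≠ 0 := by
    rw [io_intCast]; apply io_ne
    rw [Ne, Polynomial.C_eq_zero]
    exact_mod_cast hp
  have hE := hEq m1
  rw [sub_self, hHm, hP (m1 - (n 0 * r - -(n 1 : ℤ))) (by omega),
    hQ (m1 - (n 0 * r - -(n 1 : ℤ))) (by omega), hP (m1 - (-(n 1 : ℤ) * b - n 0)) (by omega)] at hE
  have hE1 : io Hm = io (Polynomial.C c1 * Polynomial.X ^ s) * P 0 := by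
    apply mul_left_cancel₀ hR
    rw [hE]
    ring
  have hHG : Hm * G = (Polynomial.C c1 * Polynomial.X ^ s) * Polynomial.derivative G := by
    apply io_inj
    have : io Hm * io G = io (Polynomial.C c1 * Polynomial.X ^ s) * io (Polynomial.derivative G) := by
      rw [hE1, ← hPG]; ring
    simpa [io] using this
  obtain ⟨-, hHt⟩ := poly_top hG c1 hc1 s hs (Polynomial.natDegree_C_mul_X_pow _ _ hc1)
    (by simp) hHG
  have hdv : Polynomial.X ^ s ∣ Hm * G := by
    rw [hHG]; exact ⟨Polynomial.C c1 * Polynomial.derivative G, by ring⟩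
  have hdv2 := Polynomial.prime_X.pow_dvd_of_dvd_mul_right s
    (fun hx => hG0 (Polynomial.X_dvd_iff.1 hx)) hdv
  rw [Polynomial.X_pow_dvd_iff] at hdv2
  rw [hdv2 (s - 1) (by omega)] at hHt
  exact mul_ne_zero hc1 (Nat.cast_ne_zero.2 hdeg) hHt.symm

end
end SD


namespace SD
noncomputable section
variable {k : Type*} [Field k]

/-- iterated polynomial ring -/
def Bi : MvPolynomial (Fin 2) k →+* Polynomial (Polynomial k) :=
  eval₂Hom (Polynomial.C.comp Polynomial.C) ![Polynomial.C Polynomial.X, Polynomial.X]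

lemma Bi_mono (m : Fin 2 →₀ ℕ) (c : k) :
    Bi (monomial m c) = Polynomial.monomial (m 1) (Polynomial.monomial (m 0) c) := by
  unfold Bi
  rw [coe_eval₂Hom, eval₂_monomial, Finsupp.prod_fintype _ _ (by simp), Fin.prod_univ_two]
  simp only [Matrix.cons_val_zero, Matrix.cons_val_one, RingHom.comp_apply]
  rw [← Polynomial.C_mul_X_pow_eq_monomial, ← Polynomial.C_mul_X_pow_eq_monomial]
  simp only [map_mul, map_pow]
  ring

lemma Bi_coeff (F : MvPolynomial (Fin 2) k) (m : Fin 2 →₀ ℕ) :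
    ((Bi F).coeff (m 1)).coeff (m 0) = F.coeff m := by
  induction F using MvPolynomial.induction_on' with
  | add F1 F2 h1 h2 => simp [h1, h2]
  | monomial n c =>
    rw [Bi_mono, Polynomial.coeff_monomial, coeff_monomial]
    by_cases h : n = m
    · simp [h]
    · rw [if_neg h]
      split_ifs with h1
      · rw [Polynomial.coeff_monomial, if_neg]
        intro h0
        exact h (ext2 h0 h1)
      · simp

lemma Bi_pd0 (F : MvPolynomial (Fin 2) k) (j : ℕ) :
    (Bi (pderiv 0 F)).coeff j = Polynomial.derivative ((Bi F).coeff j) := by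
  induction F using MvPolynomial.induction_on' with
  | add F1 F2 h1 h2 => simp [h1, h2]
  | monomial m c =>
    rw [pderiv_monomial, Bi_mono, Bi_mono]
    have h1 : (m - (Finsupp.single (0 : Fin 2) 1 : Fin 2 →₀ ℕ)) 1 = m 1 := by simp
    have h0 : (m - (Finsupp.single (0 : Fin 2) 1 : Fin 2 →₀ ℕ)) 0 = m 0 - 1 := by simp
    rw [h1, h0, Polynomial.coeff_monomial, Polynomial.coeff_monomial]
    split_ifs
    · rw [Polynomial.derivative_monomial]
    · simp

lemma Bi_pd1 (F : MvPolynomial (Fin 2) k) :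
    Bi (pderiv 1 F) = Polynomial.derivative (Bi F) := by
  induction F using MvPolynomial.induction_on' with
  | add F1 F2 h1 h2 => simp [h1, h2]
  | monomial m c =>
    rw [pderiv_monomial, Bi_mono, Bi_mono, Polynomial.derivative_monomial]
    have h1 : (m - (Finsupp.single (1 : Fin 2) 1 : Fin 2 →₀ ℕ)) 1 = m 1 - 1 := by simp
    have h0 : (m - (Finsupp.single (1 : Fin 2) 1 : Fin 2 →₀ ℕ)) 0 = m 0 := by simp
    rw [h1, h0]
    congr 1
    rw [mul_comm c, ← Polynomial.C_mul_monomial]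
    simp [mul_comm]

/-- no polynomial solution -/
lemma no_sol [CharZero k] (a b : ℕ) (hab : a < b) (A B : k) (hA : A ≠ 0) (hB : B ≠ 0)
    (hnd : ¬ (a + 1) ∣ (b - a)) (g : Polynomial k)
    (hg : Polynomial.derivative g = Polynomial.C A * Polynomial.X ^ a * g
      + Polynomial.C B * Polynomial.X ^ b) : False := by
  have hco : ∀ i, g.coeff (i + 1) * (i + 1) = A * (if a ≤ i then g.coeff (i - a) else 0)
      + B * (if i = b then 1 else 0) := by
    intro i
    have := congrArg (fun p => Polynomial.coeff p i) hg
    simp only [Polynomial.coeff_derivative, Polynomial.coeff_add, mul_assoc, Polynomial.coeff_C_mul,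
      Polynomial.coeff_X_pow_mul', Polynomial.coeff_X_pow] at this
    exact this
  have hup : ∀ l : ℕ, g.coeff (b + 1 + l * (a + 1)) = 0 → g.coeff (b + 1) = 0 := by
    intro l
    induction l with
    | zero => simp
    | succ l ih =>
      intro h0
      apply ih
      have := hco (b + l * (a + 1) + (a + 1))
      rw [if_neg (show ¬ b + l * (a + 1) + (a + 1) = b by omega),
        if_pos (show a ≤ b + l * (a + 1) + (a + 1) by omega),
        show b + l * (a + 1) + (a + 1) + 1 = b + 1 + (l + 1) * (a + 1) by ring, h0,
        show b + l * (a + 1) + (a + 1) - a = b + 1 + l * (a + 1) by omega] at this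
      simp only [zero_mul, mul_zero, add_zero] at this
      exact (mul_eq_zero.1 this.symm).resolve_left hA
  have h1 : g.coeff (b + 1) = 0 := by
    apply hup (g.natDegree + 1)
    apply Polynomial.coeff_eq_zero_of_natDegree_lt
    nlinarith [Nat.zero_le a, Nat.zero_le b, Nat.zero_le (g.natDegree * a)]
  have hdown : ∀ j ≤ b, ¬ (a + 1) ∣ j → g.coeff j = 0 := by
    intro j
    induction j using Nat.strong_induction_on with
    | _ j ih =>
      intro hj hnj
      cases j with
      | zero => exact absurd (dvd_zero _) hnj
      | succ i =>
        have h2 := hco i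
        rw [if_neg (show ¬ i = b by omega)] at h2
        have h3 : (if a ≤ i then g.coeff (i - a) else 0) = 0 := by
          split_ifs with h
          · apply ih _ (by omega) (by omega)
            intro hd
            apply hnj
            have : i + 1 = (i - a) + (a + 1) := by omega
            rw [this]
            exact dvd_add hd dvd_rfl
          · rfl
        rw [h3, mul_zero, mul_zero, add_zero] at h2
        exact (mul_eq_zero.1 h2).resolve_right (Nat.cast_add_one_ne_zero i)
  have h2 := hco b
  rw [if_pos hab.le, h1, hdown (b - a) (by omega) hnd] at h2
  simp at h2
  exact hB h2.symm

theorem case_lin [CharZero k] (a b : ℕ) (c1 c2 : k) (hc1 : c1 ≠ 0) (hc2 : c2 ≠ 0)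
    (hab : a < b) (hnd : ¬ (a + 1) ∣ (b - a)) (F h : MvPolynomial (Fin 2) k) (hF : F ≠ 0)
    (hd : X 1 ^ 0 * pderiv 0 F + (C c1 * X 0 ^ a * X 1 ^ 1 + C c2 * X 0 ^ b) * pderiv 1 F = h * F)
    (hh : ∀ m, h.coeff m ≠ 0 → m 1 < 0 + 1) : ∀ m, F.coeff m ≠ 0 → m = 0 := by
  set f := Bi F with hf
  have hX0 : Bi (k := k) (X 0) = Polynomial.C Polynomial.X := by simp [Bi]
  have hX1 : Bi (k := k) (X 1) = Polynomial.X := by simp [Bi]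
  have hC : ∀ c : k, Bi (C c) = Polynomial.C (Polynomial.C c) := by intro c; simp [Bi]
  have hh0 : Bi h = Polynomial.C ((Bi h).coeff 0) := by
    ext j i
    cases j with
    | zero => simp
    | succ j =>
      have := Bi_coeff h (Finsupp.single 0 i + Finsupp.single 1 (j + 1))
      simp only [Finsupp.add_apply] at this
      simp at this
      rw [this, Polynomial.coeff_C]
      simp
      by_contra hne
      have := hh _ hne
      simp at this
  set η := (Bi h).coeff 0 with hη
  have heq : ∀ j : ℕ, Polynomial.derivative (f.coeff j)
      + Polynomial.C c1 * Polynomial.X ^ a * (j : Polynomial k) * f.coeff j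
      + Polynomial.C c2 * Polynomial.X ^ b * ((j : Polynomial k) + 1) * f.coeff (j + 1)
      = η * f.coeff j := by
    intro j
    have h1 := congrArg (fun p => (Bi p).coeff j) hd
    have h2 : Bi (C c1 * X 0 ^ a * X 1 ^ 1 + C c2 * X 0 ^ b) =
        Polynomial.C (Polynomial.C c1 * Polynomial.X ^ a) * Polynomial.X
        + Polynomial.C (Polynomial.C c2 * Polynomial.X ^ b) := by
      simp only [map_add, map_mul, map_pow, hX0, hX1, hC, pow_one]
    simp only [pow_zero, one_mul] at h1
    rw [map_add, map_mul, map_mul, h2, Bi_pd1, ← hf, hh0, Polynomial.coeff_add, Bi_pd0, ← hf,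
      add_mul, mul_assoc, Polynomial.coeff_add, Polynomial.coeff_C_mul, Polynomial.coeff_C_mul,
      Polynomial.coeff_C_mul, Polynomial.coeff_derivative] at h1
    rw [← h1]
    cases j with
    | zero => simp
    | succ j =>
      rw [Polynomial.coeff_X_mul, Polynomial.coeff_derivative]
      push_cast
      ring
  have hf0 : f ≠ 0 := by
    intro h0
    apply hF
    ext m
    rw [← Bi_coeff F m, ← hf, h0]; simp
  set n := f.natDegree with hn
  have hlead : f.coeff n ≠ 0 := Polynomial.leadingCoeff_ne_zero.2 hf0
  have hn1 : f.coeff (n + 1) = 0 := Polynomial.coeff_eq_zero_of_natDegree_lt (by omega)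
  have h1 := heq n
  rw [hn1, mul_zero, add_zero] at h1
  have hder : Polynomial.derivative (f.coeff n) = 0 := by
    by_contra hne
    have hdv : f.coeff n ∣ Polynomial.derivative (f.coeff n) :=
      ⟨η - Polynomial.C c1 * Polynomial.X ^ a * (n : Polynomial k), by linear_combination h1⟩
    have h3 := Polynomial.natDegree_le_of_dvd hdv hne
    have h4 : (f.coeff n).natDegree ≠ 0 := by
      intro h0
      exact hne (Polynomial.derivative_of_natDegree_zero h0)
    have h5 := Polynomial.natDegree_derivative_lt (p := f.coeff n) (by omega)
    omega
  have hdeg := Polynomial.derivative_eq_zero.1 hder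
  obtain ⟨α, hα⟩ := Polynomial.natDegree_eq_zero.1 hdeg
  by_cases hn0 : n = 0
  · intro m hm
    rw [← Bi_coeff F m, ← hf] at hm
    have hm1 : m 1 = 0 := by
      have : m 1 ≤ f.natDegree := by
        apply Polynomial.le_natDegree_of_ne_zero
        intro h0; rw [h0] at hm; simp at hm
      omega
    rw [hm1] at hm
    rw [hn0] at hα
    have hm0 : m 0 = 0 := by
      by_contra hne
      rw [← hα, Polynomial.coeff_C, if_neg hne] at hm
      exact hm rfl
    exact ext2 hm0 hm1
  · exfalso
    obtain ⟨t, ht⟩ := Nat.exists_eq_succ_of_ne_zero hn0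
    have hηe : η = Polynomial.C c1 * Polynomial.X ^ a * (n : Polynomial k) := by
      apply mul_right_cancel₀ hlead
      rw [hder, zero_add] at h1
      exact h1.symm
    have h2 := heq t
    have hα0 : α ≠ 0 := by
      rintro rfl
      apply hlead
      rw [← hα]; simp
    have ht' : t + 1 = n := by omega
    rw [ht', ← hα, hηe] at h2
    have hnt : (n : Polynomial k) = (t : Polynomial k) + 1 := by rw [← ht']; push_cast; rfl
    refine no_sol a b hab c1 (-c2 * ((t : k) + 1) * α) hc1 ?_ hnd (f.coeff t) ?_
    · exact mul_ne_zero (mul_ne_zero (neg_ne_zero.2 hc2) (Nat.cast_add_one_ne_zero t)) hα0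
    · simp only [Polynomial.C_mul, Polynomial.C_neg, Polynomial.C_add, Polynomial.C_1,
        Polynomial.C_eq_natCast, Polynomial.map_natCast] at h2 ⊢
      rw [hnt] at h2
      linear_combination h2

end
end SD


namespace SD
noncomputable section
variable {k : Type*} [Field k]

lemma deg_bound (r a s b : ℕ) (c1 c2 : k) (hs : 1 ≤ s)
    (F h : MvPolynomial (Fin 2) k) (hF : F ≠ 0)
    (hd : X 1 ^ r * pderiv 0 F + (C c1 * X 0 ^ a * X 1 ^ s + C c2 * X 0 ^ b) * pderiv 1 F = h * F) :
    ∀ m, h.coeff m ≠ 0 → m 1 < r + s := by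
  intro m hm
  set f := Bi F with hf
  have hf0 : f ≠ 0 := by
    intro h0
    apply hF
    ext m
    rw [← Bi_coeff F m, ← hf, h0]; simp
  rw [← Bi_coeff h m] at hm
  have hm1 : m 1 ≤ (Bi h).natDegree := by
    apply Polynomial.le_natDegree_of_ne_zero
    intro h0; rw [h0] at hm; simp at hm
  have hh0 : Bi h ≠ 0 := by intro h0; rw [h0] at hm; simp at hm
  have h1 := congrArg (fun p => (Bi p).natDegree) hd
  rw [map_mul Bi h F, Polynomial.natDegree_mul hh0 hf0, map_add, map_mul, map_mul, Bi_pd1, ← hf] at h1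
  have e1 : (Bi (X 1 ^ r) * Bi (pderiv 0 F)).natDegree ≤ r + f.natDegree := by
    refine Polynomial.natDegree_mul_le.trans (add_le_add ?_ ?_)
    · have : Bi (k := k) (X 1) = Polynomial.X := by simp [Bi]
      rw [map_pow, this, Polynomial.natDegree_X_pow]
    · rw [Polynomial.natDegree_le_iff_coeff_eq_zero]
      intro j hj
      rw [Bi_pd0, ← hf, Polynomial.coeff_eq_zero_of_natDegree_lt hj]; simp
  have e2 : (Bi (C c1 * X 0 ^ a * X 1 ^ s + C c2 * X 0 ^ b) * Polynomial.derivative f).natDegree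
      < r + s + f.natDegree := by
    by_cases hn : f.natDegree = 0
    · rw [Polynomial.derivative_of_natDegree_zero hn, mul_zero]
      simp; omega
    · have h2 : Bi (C c1 * X 0 ^ a * X 1 ^ s + C c2 * X 0 ^ b) =
          Polynomial.C (Polynomial.C c1 * Polynomial.X ^ a) * Polynomial.X ^ s
          + Polynomial.C (Polynomial.C c2 * Polynomial.X ^ b) := by
        simp [Bi]
      have h3 : (Bi (C c1 * X 0 ^ a * X 1 ^ s + C c2 * X 0 ^ b)).natDegree ≤ s := by
        rw [h2, Polynomial.natDegree_add_C]
        exact Polynomial.natDegree_C_mul_X_pow_le _ _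
      have h4 := Polynomial.natDegree_derivative_lt hn
      have h5 := Polynomial.natDegree_mul_le (p := Bi (C c1 * X 0 ^ a * X 1 ^ s + C c2 * X 0 ^ b))
        (q := Polynomial.derivative f)
      omega
  have e3 := Polynomial.natDegree_add_le (Bi (X 1 ^ r) * Bi (pderiv 0 F))
    (Bi (C c1 * X 0 ^ a * X 1 ^ s + C c2 * X 0 ^ b) * Polynomial.derivative f)
  rw [h1] at e3
  rcases le_max_iff.1 e3 with h | h <;> omega

abbrev RR (k : Type*) [Field k] := MvPolynomial (Fin 2) k

lemma rad_inv [CharZero k] (d : Derivation k (RR k) (RR k)) (I : Ideal (RR k))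
    (hI : ∀ f ∈ I, d f ∈ I) : ∀ f ∈ I.radical, d f ∈ I.radical := by
  have step : ∀ (f : RR k) (n m : ℕ), f ^ (n + 1) * (d f) ^ m ∈ I → f ^ n * (d f) ^ (m + 2) ∈ I := by
    intro f n m hm
    have h1 := I.mul_mem_left (d f) (hI _ hm)
    rw [Derivation.leibniz, Derivation.leibniz_pow, Derivation.leibniz_pow] at h1
    simp only [smul_eq_mul, nsmul_eq_mul, Nat.add_sub_cancel] at h1
    have h2 : d f * (f ^ (n + 1) * (m * (d f ^ (m - 1) * d (d f)))) ∈ I := by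
      cases m with
      | zero => simp
      | succ m =>
        have := I.mul_mem_left (((m + 1 : ℕ) : RR k) * d (d f)) hm
        convert this using 1
        simp only [Nat.add_sub_cancel]
        ring
    have h3 := I.mul_mem_left (C ((n : k) + 1)⁻¹) (I.sub_mem h1 h2)
    convert h3 using 1
    have h4 : C ((n : k) + 1)⁻¹ * ((n + 1 : ℕ) : RR k) = 1 := by
      have : ((n + 1 : ℕ) : RR k) = C ((n : k) + 1) := by simp
      rw [this, ← C_mul, inv_mul_cancel₀ (Nat.cast_add_one_ne_zero n), C_1]
    linear_combination -(f ^ n * d f ^ (m + 2)) * h4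
  have all : ∀ (f : RR k) (n m : ℕ), f ^ n * (d f) ^ m ∈ I → (d f) ^ (m + 2 * n) ∈ I := by
    intro f n
    induction n with
    | zero => intro m hm; simpa using hm
    | succ n ih =>
      intro m hm
      have := ih _ (step f n m hm)
      convert this using 2
      ring
  intro f hf
  obtain ⟨n, hn⟩ := hf
  exact ⟨_, all f n 0 (by simpa using hn)⟩

lemma exists_prime_inv [CharZero k] (d : Derivation k (RR k) (RR k)) (I : Ideal (RR k))
    (hI : ∀ f ∈ I, d f ∈ I) (ht : I ≠ ⊤) :
    ∃ P : Ideal (RR k), I ≤ P ∧ P.IsPrime ∧ ∀ f ∈ P, d f ∈ P := by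
  obtain ⟨P, ⟨hP1, hP2, hP3⟩, hmax⟩ := WellFounded.has_min
    (wellFounded_gt : WellFounded ((· > ·) : Ideal (RR k) → Ideal (RR k) → Prop))
    {J | I ≤ J ∧ J ≠ ⊤ ∧ ∀ f ∈ J, d f ∈ J} ⟨I, le_rfl, ht, hI⟩
  have hm : ∀ J : Ideal (RR k), P ≤ J → J ≠ ⊤ → (∀ f ∈ J, d f ∈ J) → J = P := by
    intro J h1 h2 h3
    by_contra hne
    exact hmax J ⟨hP1.trans h1, h2, h3⟩ (lt_of_le_of_ne h1 (Ne.symm hne))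
  have hrad : P.radical = P := hm _ Ideal.le_radical (by
    rw [Ne, Ideal.radical_eq_top]; exact hP2) (rad_inv d P hP3)
  refine ⟨P, hP1, ⟨hP2, ?_⟩, hP3⟩
  intro a b hab
  by_cases ha : a ∈ P
  · exact Or.inl ha
  right
  let J : Ideal (RR k) :=
    { carrier := {f | a * f ∈ P}
      add_mem' := by
        intro x y hx hy
        change a * (x + y) ∈ P
        rw [mul_add]; exact P.add_mem hx hy
      zero_mem' := by change a * 0 ∈ P; simp
      smul_mem' := by
        intro c x hx
        change a * (c * x) ∈ P
        rw [mul_left_comm]; exact P.mul_mem_left c hx }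
  have hJ : J = P := by
    apply hm
    · intro x hx; exact P.mul_mem_left a hx
    · intro h
      have : (1 : RR k) ∈ J := by rw [h]; trivial
      have h1 : a * 1 ∈ P := this
      rw [mul_one] at h1
      exact ha h1
    · intro f hf
      have hf' : a * f ∈ P := hf
      change a * d f ∈ P
      rw [← hrad]
      refine ⟨2, ?_⟩
      have h1 := P.mul_mem_left (a * d f) (hP3 _ hf')
      rw [Derivation.leibniz] at h1
      simp only [smul_eq_mul] at h1
      have h2 := P.mul_mem_left (d f * d a) hf'
      have h3 := P.sub_mem h1 h2
      convert h3 using 1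
      ring
  rw [← hJ]
  exact hab

lemma prime_max (f : RR k) (hf : Prime f) (P : Ideal (RR k)) (hP : P.IsPrime) (hfP : f ∈ P)
    (hne : P ≠ Ideal.span {f}) : P.IsMaximal := by
  by_contra hmx
  obtain ⟨M, hM, hPM⟩ := P.exists_le_maximal hP.ne_top
  have hlt3 : P < M := lt_of_le_of_ne hPM (by rintro rfl; exact hmx hM)
  have hlt2 : Ideal.span {f} < P := lt_of_le_of_ne
    ((Ideal.span_singleton_le_iff_mem _).2 hfP) (Ne.symm hne)
  have hlt1 : (⊥ : Ideal (RR k)) < Ideal.span {f} := by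
    rw [bot_lt_iff_ne_bot, Ne, Ideal.span_singleton_eq_bot]; exact hf.ne_zero
  have hpf : (Ideal.span {f}).IsPrime := (Ideal.span_singleton_prime hf.ne_zero).2 hf
  let x0 : PrimeSpectrum (RR k) := ⟨⊥, Ideal.isPrime_bot⟩
  let x1 : PrimeSpectrum (RR k) := ⟨Ideal.span {f}, hpf⟩
  let x2 : PrimeSpectrum (RR k) := ⟨P, hP⟩
  let x3 : PrimeSpectrum (RR k) := ⟨M, hM.isPrime⟩
  let S : LTSeries (PrimeSpectrum (RR k)) :=
    { length := 3
      toFun := ![x0, x1, x2, x3]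
      step := by
        intro i
        fin_cases i
        · exact hlt1
        · exact hlt2
        · exact hlt3 }
  have h1 : (S.length : WithBot ℕ∞) ≤ ringKrullDim (RR k) := Order.LTSeries.length_le_krullDim S
  rw [MvPolynomial.ringKrullDim_of_isNoetherianRing, ringKrullDim_eq_zero_of_field] at h1
  simp [S] at h1
  exact absurd h1 (by decide)

lemma darboux [CharZero k] (d : Derivation k (RR k) (RR k)) (r : ℕ) (hx : d (X 0) = X 1 ^ r)
    (hy : ∀ J : Ideal (RR k), J.IsPrime → (∀ f ∈ J, d f ∈ J) → X 1 ^ r ∉ J)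
    (hns : ¬ ∀ I : Ideal (RR k), (∀ f ∈ I, d f ∈ I) → I = ⊥ ∨ I = ⊤) :
    ∃ F h : RR k, F ≠ 0 ∧ ¬ IsUnit F ∧ d F = h * F := by
  push Not at hns
  obtain ⟨I, hI, hb, ht⟩ := hns
  obtain ⟨P, hIP, hP, hPd⟩ := exists_prime_inv d I hI ht
  have hPb : P ≠ ⊥ := by rintro rfl; exact hb (le_bot_iff.1 hIP)
  obtain ⟨f, hfP, hf⟩ := hP.exists_mem_prime_of_ne_bot hPb
  by_cases hPf : P = Ideal.span {f}
  · have h1 := hPd f hfP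
    rw [hPf, Ideal.mem_span_singleton] at h1
    obtain ⟨h, hh⟩ := h1
    exact ⟨f, h, hf.ne_zero, hf.not_isUnit, by rw [hh, mul_comm]⟩
  exfalso
  have hmax := prime_max f hf P hP hfP hPf
  let _ : Field (RR k ⧸ P) := Ideal.Quotient.field P
  have : Module.Finite k (RR k ⧸ P) := finite_of_finite_type_of_isJacobsonRing k (RR k ⧸ P)
  set xb : RR k ⧸ P := Ideal.Quotient.mkₐ k P (X 0) with hxb
  have hinteg : IsIntegral k xb := IsIntegral.of_finite k xb
  have hirr := minpoly.irreducible hinteg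
  have hmem : ∀ p : Polynomial k, Polynomial.aeval (X 0 : RR k) p ∈ P ↔ Polynomial.aeval xb p = 0 := by
    intro p
    rw [hxb, Polynomial.aeval_algHom_apply, Ideal.Quotient.mkₐ_eq_mk, Ideal.Quotient.eq_zero_iff_mem]
  have h1 := hPd _ ((hmem _).2 (minpoly.aeval k xb))
  rw [Derivation.map_aeval, hx, smul_eq_mul] at h1
  rcases hP.mem_or_mem h1 with h2 | h2
  · exact hirr.separable.aeval_derivative_ne_zero (minpoly.aeval k xb) ((hmem _).1 h2)
  · exact hy P hP hPd h2

end
end SD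

namespace SD
noncomputable section
variable {k : Type*} [Field k]

lemma mk_apply (u v : RR k) (F : RR k) :
    MvPolynomial.mkDerivation k ![u, v] F = u * pderiv 0 F + v * pderiv 1 F := by
  have : MvPolynomial.mkDerivation k ![u, v] = u • pderiv 0 + v • pderiv 1 := by
    apply MvPolynomial.derivation_ext
    intro i
    fin_cases i <;> simp [mkDerivation_X]
  rw [this]
  simp

lemma unit_const (F : RR k) (hF : F ≠ 0) (h : ∀ m, F.coeff m ≠ 0 → m = 0) : IsUnit F := by
  have h1 : F = C (F.coeff 0) := by
    ext m
    rw [coeff_C]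
    split_ifs with hm
    · rw [hm]
    · by_contra hne
      exact hm (h m hne).symm
  rw [h1]
  apply IsUnit.map
  rw [isUnit_iff_ne_zero]
  intro h0
  rw [h0] at h1
  exact hF (by rw [h1]; simp)

lemma nec [CharZero k] (d : Derivation k (RR k) (RR k)) (hs : IsSimpleDerivation d) (g h : RR k)
    (hg : d g = h * g) : pderiv 1 g = 0 := by
  by_contra hne
  have hinv : ∀ f ∈ Ideal.span {g}, d f ∈ Ideal.span {g} := by
    intro f hf
    rw [Ideal.mem_span_singleton] at hf ⊢
    obtain ⟨a, rfl⟩ := hf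
    rw [Derivation.leibniz, hg]
    simp only [smul_eq_mul]
    exact ⟨d a + a * h, by ring⟩
  rcases hs _ hinv with h1 | h1
  · rw [Ideal.span_singleton_eq_bot] at h1
    apply hne; rw [h1]; simp
  · rw [Ideal.span_singleton_eq_top, MvPolynomial.isUnit_iff_eq_C_of_isReduced] at h1
    obtain ⟨c, -, rfl⟩ := h1
    apply hne
    simp

lemma C_nat (n : ℕ) : (C (n : k) : RR k) = (n : RR k) := by simp

lemma sol_exists [CharZero k] (t : ℕ) (c2 : k) (hc2 : c2 ≠ 0) (n : ℕ) : ∀ c : k,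
    ∃ f : Polynomial k, Polynomial.derivative f = Polynomial.C c2 * Polynomial.X ^ t * f
      + Polynomial.C c * Polynomial.X ^ (t + n * (t + 1)) := by
  induction n with
  | zero =>
    intro c
    refine ⟨Polynomial.C (-(c / c2)), ?_⟩
    have : Polynomial.C c2 * Polynomial.C (-(c / c2)) = - Polynomial.C c := by
      rw [← Polynomial.C_mul, ← Polynomial.C_neg]
      congr 1
      field_simp
    simp only [zero_mul, add_zero, Polynomial.derivative_C]
    linear_combination (-Polynomial.X ^ t) * this
  | succ n ih =>
    intro c
    obtain ⟨f1, hf1⟩ := ih ((c / c2) * (((n + 1) * (t + 1) : ℕ) : k))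
    refine ⟨f1 + Polynomial.C (-(c / c2)) * Polynomial.X ^ ((n + 1) * (t + 1)), ?_⟩
    have h1 : Polynomial.C c2 * Polynomial.C (-(c / c2)) = - Polynomial.C c := by
      rw [← Polynomial.C_mul, ← Polynomial.C_neg]
      congr 1
      field_simp
    rw [Polynomial.derivative_add, hf1, Polynomial.derivative_C_mul, Polynomial.derivative_X_pow]
    have h2 : (n + 1) * (t + 1) - 1 = t + n * (t + 1) := by
      have : (n + 1) * (t + 1) = t + n * (t + 1) + 1 := by ring
      omega
    rw [h2, Polynomial.C_mul, Polynomial.C_neg]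
    rw [Polynomial.C_neg] at h1
    rw [show t + (n + 1) * (t + 1) = (n + 1) * (t + 1) + t by ring, pow_add _ ((n + 1) * (t + 1)) t]
    linear_combination (-(Polynomial.X ^ ((n + 1) * (t + 1)) * Polynomial.X ^ t)) * h1

section nec_sec
variable [CharZero k] (r t₁ s₁ t₂ s₂ : ℕ) (c₁ c₂ : k)

/-- the derivation -/
abbrev DD : Derivation k (RR k) (RR k) := MvPolynomial.mkDerivation k
        ![X 1 ^ r, C c₁ * X 0 ^ t₁ * X 1 ^ s₁ + C c₂ * X 0 ^ t₂ * X 1 ^ s₂]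

lemma N1 (h1 : c₁ = 0 ∨ s₁ = 0) (h2 : c₂ = 0 ∨ s₂ = 0) :
    ¬ IsSimpleDerivation (DD r t₁ s₁ t₂ s₂ c₁ c₂) := by
  intro hs
  have e1 : (C c₁ * X 0 ^ t₁ * X 1 ^ s₁ : RR k) = C c₁ * X 0 ^ t₁ := by
    rcases h1 with h | h <;> simp [h]
  have e2 : (C c₂ * X 0 ^ t₂ * X 1 ^ s₂ : RR k) = C c₂ * X 0 ^ t₂ := by
    rcases h2 with h | h <;> simp [h]
  have h := nec _ hs (X 1 ^ (r + 1) - ((r + 1 : ℕ) : RR k) * (C (c₁ / ((t₁ + 1 : ℕ) : k)) * X 0 ^ (t₁ + 1)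
    + C (c₂ / ((t₂ + 1 : ℕ) : k)) * X 0 ^ (t₂ + 1))) 0 (by
      rw [DD, mk_apply, e1, e2]
      have a1 : (C (c₁ / ((t₁ + 1 : ℕ) : k)) * ((t₁ + 1 : ℕ) : RR k)) = C c₁ := by
        rw [← C_nat, ← C_mul, div_mul_cancel₀ _ (Nat.cast_ne_zero.2 (by omega))]
      have a2 : (C (c₂ / ((t₂ + 1 : ℕ) : k)) * ((t₂ + 1 : ℕ) : RR k)) = C c₂ := by
        rw [← C_nat, ← C_mul, div_mul_cancel₀ _ (Nat.cast_ne_zero.2 (by omega))]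
      simp only [map_sub, map_add, Derivation.leibniz, Derivation.leibniz_pow, pderiv_X, pderiv_C,
        Derivation.map_natCast, smul_eq_mul, nsmul_eq_mul, Nat.add_sub_cancel, Pi.single_apply]
      simp only [Fin.isValue, one_ne_zero, zero_ne_one, if_true, if_false]
      linear_combination (-((r + 1 : ℕ) : RR k) * X 1 ^ r * X 0 ^ t₁) * a1
        - (((r + 1 : ℕ) : RR k) * X 1 ^ r * X 0 ^ t₂) * a2)
  simp only [map_sub, map_add, Derivation.leibniz, Derivation.leibniz_pow, pderiv_X, pderiv_C,
        Derivation.map_natCast, smul_eq_mul, nsmul_eq_mul, Nat.add_sub_cancel, Pi.single_apply] at h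
  simp only [Fin.isValue, one_ne_zero, zero_ne_one, if_true, if_false, mul_zero, add_zero, sub_zero,
    mul_one] at h
  exact mul_ne_zero (Nat.cast_ne_zero.2 (by omega)) (pow_ne_zero _ (X_ne_zero _)) h

lemma N2 (h1 : c₁ = 0 ∨ 0 < s₁) (h2 : c₂ = 0 ∨ 0 < s₂) :
    ¬ IsSimpleDerivation (DD r t₁ s₁ t₂ s₂ c₁ c₂) := by
  intro hs
  have e1 : (C c₁ * X 0 ^ t₁ * X 1 ^ s₁ : RR k) = C c₁ * X 0 ^ t₁ * X 1 ^ (s₁ - 1) * X 1 := by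
    rcases h1 with h | h
    · simp [h]
    · obtain ⟨u, rfl⟩ : ∃ u, s₁ = u + 1 := ⟨s₁ - 1, by omega⟩
      rw [Nat.add_sub_cancel]; ring
  have e2 : (C c₂ * X 0 ^ t₂ * X 1 ^ s₂ : RR k) = C c₂ * X 0 ^ t₂ * X 1 ^ (s₂ - 1) * X 1 := by
    rcases h2 with h | h
    · simp [h]
    · obtain ⟨u, rfl⟩ : ∃ u, s₂ = u + 1 := ⟨s₂ - 1, by omega⟩
      rw [Nat.add_sub_cancel]; ring
  have h := nec _ hs (X 1) (C c₁ * X 0 ^ t₁ * X 1 ^ (s₁ - 1) + C c₂ * X 0 ^ t₂ * X 1 ^ (s₂ - 1)) (by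
    rw [DD, mk_apply, e1, e2]
    simp only [pderiv_X, Pi.single_apply]
    simp only [Fin.isValue, one_ne_zero, if_true, if_false]
    ring)
  simp at h

lemma N3 (t : ℕ) (h1 : c₁ ≠ 0) (h2 : c₂ ≠ 0) (hne : s₁ ≠ s₂) :
    ¬ IsSimpleDerivation (DD r t s₁ t s₂ c₁ c₂) := by
  intro hs
  by_cases hp : 0 < s₁ ∧ 0 < s₂
  · exact N2 r t s₁ t s₂ c₁ c₂ (Or.inr hp.1) (Or.inr hp.2) hs
  have h := nec _ hs (C c₁ * X 1 ^ s₁ + C c₂ * X 1 ^ s₂)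
    ((C c₁ * ((s₁ : RR k) * X 1 ^ (s₁ - 1)) + C c₂ * ((s₂ : RR k) * X 1 ^ (s₂ - 1))) * X 0 ^ t) (by
    rw [DD, mk_apply]
    simp only [map_sub, map_add, Derivation.leibniz, Derivation.leibniz_pow, pderiv_X, pderiv_C,
      smul_eq_mul, nsmul_eq_mul, Pi.single_apply]
    simp only [Fin.isValue, one_ne_zero, if_true, if_false]
    ring)
  simp only [map_sub, map_add, Derivation.leibniz, Derivation.leibniz_pow, pderiv_X, pderiv_C,
      smul_eq_mul, nsmul_eq_mul, Pi.single_apply] at h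
  simp only [if_true, mul_zero, add_zero, mul_one] at h
  have hx : ∀ n : ℕ, (X 1 ^ n : RR k) ≠ 0 := fun n => pow_ne_zero _ (X_ne_zero _)
  have hC1 : (C c₁ : RR k) ≠ 0 := by rwa [Ne, C_eq_zero]
  have hC2 : (C c₂ : RR k) ≠ 0 := by rwa [Ne, C_eq_zero]
  rcases Nat.eq_zero_or_pos s₁ with h0 | h0
  · rw [h0] at h
    simp only [Nat.cast_zero, zero_mul, mul_zero, zero_add] at h
    exact mul_ne_zero hC2 (mul_ne_zero (Nat.cast_ne_zero.2 (by omega)) (hx _)) h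
  · have h3 : s₂ = 0 := by omega
    rw [h3] at h
    simp only [Nat.cast_zero, zero_mul, mul_zero, add_zero] at h
    exact mul_ne_zero hC1 (mul_ne_zero (Nat.cast_ne_zero.2 (by omega)) (hx _)) h

lemma N4 (hr : 0 < r) (h1 : ¬ (t₁ = 0 ∧ s₁ = 0)) (h2 : ¬ (t₂ = 0 ∧ s₂ = 0)) :
    ¬ IsSimpleDerivation (DD r t₁ s₁ t₂ s₂ c₁ c₂) := by
  intro hs
  have h := hs (RingHom.ker (constantCoeff : RR k →+* k)) (by
    intro f _
    rw [RingHom.mem_ker, DD, mk_apply]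
    have e0 : (0 : k) ^ r = 0 := zero_pow (by omega)
    have e1 : (0 : k) ^ t₁ * 0 ^ s₁ = 0 := by
      rw [← pow_add]; exact zero_pow (by omega)
    have e2 : (0 : k) ^ t₂ * 0 ^ s₂ = 0 := by
      rw [← pow_add]; exact zero_pow (by omega)
    simp only [map_add, map_mul, map_pow, constantCoeff_X, constantCoeff_C, mul_assoc, e0]
    rw [e1, e2]
    simp)
  rcases h with h | h
  · have : (X 0 : RR k) ∈ RingHom.ker (constantCoeff : RR k →+* k) := by
      rw [RingHom.mem_ker, constantCoeff_X]
    rw [h, Ideal.mem_bot] at this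
    exact X_ne_zero _ this
  · exact RingHom.ker_ne_top _ h

lemma N5 (h2 : c₂ ≠ 0) (hlt : t₂ < t₁) (hdv : (t₂ + 1) ∣ (t₁ - t₂)) :
    ¬ IsSimpleDerivation (DD 0 t₁ 0 t₂ 1 c₁ c₂) := by
  intro hs
  obtain ⟨n, hn⟩ := hdv
  obtain ⟨f, hf⟩ := sol_exists t₂ c₂ h2 n c₁
  have ht : t₂ + n * (t₂ + 1) = t₁ := by
    rw [mul_comm]; omega
  rw [ht] at hf
  have hf' := congrArg (Polynomial.aeval (X 0 : RR k)) hf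
  simp only [map_add, map_mul, map_pow, Polynomial.aeval_X, Polynomial.aeval_C] at hf'
  have h := nec _ hs (X 1 - Polynomial.aeval (X 0 : RR k) f) (C c₂ * X 0 ^ t₂) (by
    rw [DD, mk_apply]
    simp only [map_sub, Derivation.map_aeval, pderiv_X, Pi.single_apply, smul_eq_mul]
    simp only [Fin.isValue, one_ne_zero, zero_ne_one, if_true, if_false, hf']
    simp only [MvPolynomial.algebraMap_eq]
    ring)
  simp only [map_sub, Derivation.map_aeval, pderiv_X, Pi.single_apply, smul_eq_mul] at h
  simp at h

end nec_sec

lemma suff_aux [CharZero k] (u v : RR k) (r a s b : ℕ) (c1 c2 : k) (hu : u = X 1 ^ r)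
    (hv : v = C c1 * X 0 ^ a * X 1 ^ s + C c2 * X 0 ^ b) (hs : 1 ≤ s) (hc2 : c2 ≠ 0)
    (hrb : 0 < r → b = 0)
    (H : ∀ F h : RR k, F ≠ 0 → X 1 ^ r * pderiv 0 F +
      (C c1 * X 0 ^ a * X 1 ^ s + C c2 * X 0 ^ b) * pderiv 1 F = h * F →
      (∀ m, h.coeff m ≠ 0 → m 1 < r + s) → ∀ m, F.coeff m ≠ 0 → m = 0) :
    IsSimpleDerivation (MvPolynomial.mkDerivation k ![u, v]) := by
  by_contra hns
  obtain ⟨F, h, hF, hun, hd⟩ := darboux (MvPolynomial.mkDerivation k ![u, v]) r (by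
      simp [mkDerivation_X, hu]) (by
      intro J hJ hJd hmem
      rcases Nat.eq_zero_or_pos r with hr | hr
      · rw [hr, pow_zero] at hmem
        exact hJ.ne_top ((Ideal.eq_top_iff_one _).2 hmem)
      · have h1 := hJ.mem_of_pow_mem _ hmem
        have h2 := hJd _ h1
        rw [mk_apply, hv, hrb hr] at h2
        simp only [pderiv_X, Pi.single_apply] at h2
        simp only [Fin.isValue, one_ne_zero, if_true, if_false, mul_zero, zero_add,
          mul_one, pow_zero] at h2
        have h3 : (C c1 * X 0 ^ a * X 1 ^ s : RR k) ∈ J := J.mul_mem_left _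
          (J.pow_mem_of_mem h1 s (by omega))
        have h4 := (J.add_mem_iff_right h3).1 h2
        exact hJ.ne_top (Ideal.eq_top_of_isUnit_mem _ h4
          ((isUnit_iff_ne_zero.2 hc2).map (C : k →+* RR k)))) hns
  rw [mk_apply, hu, hv] at hd
  exact hun (unit_const F hF (H F h hF hd (deg_bound r a s b c1 c2 hs F h hF hd)))

end
end SD

theorem simple_derivation_two_term_iff
    (k : Type*) [Field k] [CharZero k]
    (r t₁ s₁ t₂ s₂ : ℕ) (hts : t₂ ≤ t₁) (hne : (t₁, s₁) ≠ (t₂, s₂))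
    (c₁ c₂ : k) :
    IsSimpleDerivation
      (MvPolynomial.mkDerivation k
        ![X 1 ^ r, C c₁ * X 0 ^ t₁ * X 1 ^ s₁ + C c₂ * X 0 ^ t₂ * X 1 ^ s₂]) ↔
      ((c₁ ≠ 0 ∧ c₂ ≠ 0 ∧ t₂ < t₁) ∧
       (0 < r → t₂ = 0 ∧ s₂ = 0 ∧ 0 < s₁) ∧
       (r = 0 → 0 < s₁ + s₂ ∧ s₁ * s₂ = 0) ∧
       (r = 0 ∧ s₁ = 0 ∧ s₂ = 1 → ¬ (t₂ + 1) ∣ (t₁ - t₂))) := by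
  constructor
  · intro hs
    have n1 : ¬ ((c₁ = 0 ∨ s₁ = 0) ∧ (c₂ = 0 ∨ s₂ = 0)) :=
      fun h => SD.N1 r t₁ s₁ t₂ s₂ c₁ c₂ h.1 h.2 hs
    have n2 : ¬ ((c₁ = 0 ∨ 0 < s₁) ∧ (c₂ = 0 ∨ 0 < s₂)) :=
      fun h => SD.N2 r t₁ s₁ t₂ s₂ c₁ c₂ h.1 h.2 hs
    have hc1 : c₁ ≠ 0 := by
      intro h0
      rcases Nat.eq_zero_or_pos s₂ with h | h
      · exact n1 ⟨Or.inl h0, Or.inr h⟩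
      · exact n2 ⟨Or.inl h0, Or.inr h⟩
    have hc2 : c₂ ≠ 0 := by
      intro h0
      rcases Nat.eq_zero_or_pos s₁ with h | h
      · exact n1 ⟨Or.inr h, Or.inl h0⟩
      · exact n2 ⟨Or.inr h, Or.inl h0⟩
    have hlt : t₂ < t₁ := by
      rcases hts.lt_or_eq with h | h
      · exact h
      · exfalso
        subst h
        exact SD.N3 r s₁ s₂ c₁ c₂ t₂ hc1 hc2 (fun h => hne (by rw [h])) hs
    refine ⟨⟨hc1, hc2, hlt⟩, ?_, ?_, ?_⟩
    · intro hr
      have h2 : t₂ = 0 ∧ s₂ = 0 := by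
        by_contra hc
        exact SD.N4 r t₁ s₁ t₂ s₂ c₁ c₂ hr (by omega) hc hs
      refine ⟨h2.1, h2.2, ?_⟩
      by_contra hc
      exact n1 ⟨Or.inr (by omega), Or.inr h2.2⟩
    · intro _
      constructor
      · by_contra hc
        exact n1 ⟨Or.inr (by omega), Or.inr (by omega)⟩
      · by_contra hc
        exact n2 ⟨Or.inr (Nat.pos_of_ne_zero (left_ne_zero_of_mul hc)),
          Or.inr (Nat.pos_of_ne_zero (right_ne_zero_of_mul hc))⟩
    · rintro ⟨rfl, rfl, rfl⟩ hdv
      exact SD.N5 t₁ t₂ c₁ c₂ hc2 hlt hdv hs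
  · rintro ⟨⟨hc1, hc2, hlt⟩, hb, hc, hd⟩
    by_cases hs2 : s₂ = 0
    · have hs1 : 0 < s₁ := by
        rcases Nat.eq_zero_or_pos r with hr | hr
        · have := (hc hr).1
          omega
        · exact (hb hr).2.2
      exact SD.suff_aux _ _ r t₁ s₁ t₂ c₁ c₂ rfl (by rw [hs2]; ring) hs1 hc2 (fun hr => (hb hr).1)
        (fun F h hF hd hh => SD.case_gt r t₁ s₁ t₂ c₁ c₂ hc1 hc2 hs1 hlt F h hF hd hh)
    · have hr : r = 0 := by
        by_contra hr
        exact hs2 (hb (Nat.pos_of_ne_zero hr)).2.1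
      have hs1 : s₁ = 0 := (mul_eq_zero.1 (hc hr).2).resolve_right hs2
      subst hr
      refine SD.suff_aux _ _ 0 t₂ s₂ t₁ c₂ c₁ rfl (by rw [hs1]; ring) (by omega) hc1 (by omega) ?_
      intro F h hF hdF hh
      by_cases h1 : s₂ = 1
      · subst h1
        exact SD.case_lin t₂ t₁ c₂ c₁ hc2 hc1 hlt (hd ⟨rfl, hs1, rfl⟩) F h hF hdF hh
      · exact SD.case_lt t₂ s₂ t₁ c₂ c₁ hc2 hc1 (by omega) hlt F h hF hdF hh
end

section
/- Let $k$ be an algebraically closed field of characteristic zero, let $s, t \geq 1$ and $u \geq 0$ be integers, set $v = t + (u+1)s$, let $\omega \in k$ be a primitive $v$-th root of unity, and let $\psi$ be the $k$-algebra automorphism of $k[x,y]$ with $\psi(x) = \omega x$ and $\psi(y) = \omega^{u+1} y$. Let $d = \partial_x + x^u(x^t y^s + 1)\partial_y$. If $d$ is not a simple derivation of $k[x,y]$, then there exist a polynomial $F \in k[x,y]$ of positive degree $m$ in $x$, written $F = \sum_{i=0}^{m} b_i x^i$ with $b_i \in k[y]$, and a non-negative integer $b$, such that $d(F) = b\, x^{t+u}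 y^{s-1} F$, $\psi(F) = F$, and the leading coefficient satisfies $b_m = y^b$. -/
open MvPolynomial

open Polynomial in
theorem aux_prim_dvd {R : Type*} [CommRing R] [IsDomain R] [StrongNormalizedGCDMonoid R]
    {g f : Polynomial R} {a : R} (ha : a ≠ 0) (hg : g.IsPrimitive)
    (h : g ∣ Polynomial.C a * f) : g ∣ f := by
  by_cases hf : f = 0
  · simp [hf]
  have h0 : Polynomial.C a * f ≠ 0 := mul_ne_zero (by simpa using ha) hf
  rw [← hg.dvd_primPart_iff_dvd h0, primPart_mul h0,
    (isUnit_primPart_C a).dvd_mul_left, hg.dvd_primPart_iff_dvd hf] at h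
  exact h

open Polynomial in
theorem aux_pseudo {R : Type*} [CommRing R] [IsDomain R] (I : Ideal (Polynomial R))
    (g : Polynomial R) (hg : g ∈ I) (hg0 : g ≠ 0)
    (hmin : ∀ f ∈ I, f ≠ 0 → g.natDegree ≤ f.natDegree) :
    ∀ n : ℕ, ∀ f ∈ I, f.natDegree ≤ n → ∃ a : R, a ≠ 0 ∧ g ∣ Polynomial.C a * f := by
  intro n
  induction n with
  | zero =>
    intro f hf hn
    by_cases hf0 : f = 0
    · exact ⟨1, one_ne_zero, by simp [hf0]⟩
    have h1 := hmin f hf hf0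
    have h2 : g.natDegree = 0 := by omega
    rw [eq_C_of_natDegree_eq_zero h2] at hg0 ⊢
    refine ⟨g.coeff 0, by simpa using hg0, Dvd.intro _ rfl⟩
  | succ n ih =>
    intro f hf hn
    by_cases hf0 : f = 0
    · exact ⟨1, one_ne_zero, by simp [hf0]⟩
    have h1 := hmin f hf hf0
    by_cases hd : f.natDegree = 0
    · exact ih f hf (by omega)
    set f1 := Polynomial.C g.leadingCoeff * f -
      Polynomial.C f.leadingCoeff * Polynomial.X ^ (f.natDegree - g.natDegree) * g with hf1
    have hf1I : f1 ∈ I := I.sub_mem (I.mul_mem_left _ hf) (I.mul_mem_left _ hg)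
    have hdeg : f1.natDegree ≤ n := by
      rw [natDegree_le_iff_coeff_eq_zero]
      intro N hN
      rw [hf1, Polynomial.coeff_sub, Polynomial.coeff_C_mul, mul_assoc, Polynomial.coeff_C_mul,
        Polynomial.coeff_X_pow_mul']
      rw [if_pos (by omega)]
      rcases Nat.lt_or_ge f.natDegree N with h | h
      · rw [coeff_eq_zero_of_natDegree_lt h, coeff_eq_zero_of_natDegree_lt (p := g) (by omega)]
        simp
      · have : N = f.natDegree := by omega
        subst this
        rw [Nat.sub_sub_self h1]
        simp only [coeff_natDegree]
        ring
    obtain ⟨a, ha, hdvd⟩ := ih f1 hf1I hdeg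
    refine ⟨a * g.leadingCoeff, mul_ne_zero ha (by simpa using hg0), ?_⟩
    have : Polynomial.C (a * g.leadingCoeff) * f = Polynomial.C a * f1 +
      (Polynomial.C a * (Polynomial.C f.leadingCoeff *
        Polynomial.X ^ (f.natDegree - g.natDegree))) * g := by
      rw [hf1, Polynomial.C_mul]; ring
    rw [this]
    exact dvd_add hdvd (Dvd.intro_left _ rfl)

open Polynomial in
theorem aux_darboux {k : Type*} [Field k] [CharZero k]
    (D : Derivation k (Polynomial (Polynomial k)) (Polynomial (Polynomial k)))
    (hD : ∀ p : Polynomial k, D (Polynomial.C p) = Polynomial.C (derivative p))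
    (I : Ideal (Polynomial (Polynomial k))) (hI : ∀ f ∈ I, D f ∈ I)
    (hbot : I ≠ ⊥) (htop : I ≠ ⊤) :
    ∃ g : Polynomial (Polynomial k), g ≠ 0 ∧ ¬ IsUnit g ∧ g ∣ D g := by
  classical
  let : StrongNormalizedGCDMonoid (Polynomial k) :=
    UniqueFactorizationMonoid.toStrongNormalizedGCDMonoid _
  have hR : ∀ n : ℕ, ∀ p : Polynomial k, p.natDegree ≤ n → Polynomial.C p ∈ I → p = 0 := by
    intro n
    induction n with
    | zero =>
      intro p hp hpI
      by_contra h0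
      apply htop
      refine I.eq_top_of_isUnit_mem hpI ?_
      rw [eq_C_of_natDegree_le_zero hp] at h0 ⊢
      have : p.coeff 0 ≠ 0 := by simpa using h0
      exact (isUnit_C.2 (isUnit_C.2 this.isUnit))
    | succ n ih =>
      intro p hp hpI
      have h1 := ih (derivative p) (by have := natDegree_derivative_le p; omega)
        (by rw [← hD]; exact hI _ hpI)
      have h2 := Polynomial.derivative_eq_zero.1 h1
      exact ih p (by omega) hpI
  have hex : ∃ n : ℕ, ∃ f ∈ I, f ≠ 0 ∧ f.natDegree = n := by
    obtain ⟨f, hf, hf0⟩ := Submodule.exists_mem_ne_zero_of_ne_bot hbot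
    exact ⟨_, f, hf, hf0, rfl⟩
  obtain ⟨g, hg, hg0, hgn⟩ := Nat.find_spec hex
  have hmin : ∀ f ∈ I, f ≠ 0 → g.natDegree ≤ f.natDegree := by
    intro f hf hf0
    rw [hgn]
    exact Nat.find_min' hex ⟨f, hf, hf0, rfl⟩
  have hprim := g.isPrimitive_primPart
  have hgeq := g.eq_C_content_mul_primPart
  have hc : g.content ≠ 0 := by simpa [content_eq_zero_iff] using hg0
  have hall : ∀ f ∈ I, g.primPart ∣ f := by
    intro f hf
    obtain ⟨a, ha, h⟩ := aux_pseudo I g hg hg0 hmin _ f hf le_rfl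
    exact aux_prim_dvd ha hprim ((g.primPart_dvd).trans h)
  refine ⟨g.primPart, g.primPart_ne_zero, ?_, ?_⟩
  · intro hu
    have h1 : g.natDegree = 0 := by
      rw [← natDegree_primPart]; exact natDegree_eq_zero_of_isUnit hu
    rw [eq_C_of_natDegree_eq_zero h1] at hg hg0
    exact hg0 (by rw [hR _ _ le_rfl hg, Polynomial.C_0])
  · have h1 := hall _ (hI g hg)
    have h2 : D g = Polynomial.C g.content * D g.primPart + g.primPart * D (Polynomial.C g.content) := by
      conv_lhs => rw [hgeq]
      rw [D.leibniz]; rfl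
    rw [h2] at h1
    exact aux_prim_dvd hc hprim ((dvd_add_left (Dvd.intro _ rfl)).1 h1)

/-- `k[x,y] ≃ k[x][y]`. -/
noncomputable def auxE (k : Type*) [Field k] :
    MvPolynomial (Fin 2) k ≃ₐ[k] Polynomial (Polynomial k) :=
  (MvPolynomial.finSuccEquiv k 1).trans
    (Polynomial.mapAlgEquiv (MvPolynomial.uniqueAlgEquiv k (Fin 1)))

theorem auxE_X0 (k : Type*) [Field k] : auxE k (X 0) = Polynomial.X := by
  simp [auxE, MvPolynomial.finSuccEquiv_X_zero]

theorem auxE_X1 (k : Type*) [Field k] : auxE k (X 1) = Polynomial.C Polynomial.X := by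
  have : (X 1 : MvPolynomial (Fin 2) k) = X (Fin.succ 0) := rfl
  rw [auxE, this, AlgEquiv.trans_apply, MvPolynomial.finSuccEquiv_X_succ]
  simp [MvPolynomial.uniqueAlgEquiv]

theorem auxE_symm_C (k : Type*) [Field k] (p : Polynomial k) :
    (auxE k).symm (Polynomial.C p) = Polynomial.aeval (X 1) p := by
  rw [AlgEquiv.symm_apply_eq]
  rw [← Polynomial.aeval_algHom_apply, auxE_X1]
  induction p using Polynomial.induction_on' with
  | add p q hp hq => simp [hp, hq]
  | monomial n a =>
    rw [Polynomial.aeval_monomial, ← Polynomial.C_mul_X_pow_eq_monomial]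
    simp

theorem aux_exists {k : Type*} [Field k] [CharZero k]
    (d : Derivation k (MvPolynomial (Fin 2) k) (MvPolynomial (Fin 2) k))
    (hd : d (X 0) = 1) (hns : ¬ IsSimpleDerivation d) :
    ∃ g : MvPolynomial (Fin 2) k, g ≠ 0 ∧ ¬ IsUnit g ∧ g ∣ d g := by
  unfold IsSimpleDerivation at hns
  push Not at hns
  obtain ⟨I, hI, hbot, htop⟩ := hns
  let e : MvPolynomial (Fin 2) k ≃ₐ[k] Polynomial (Polynomial k) :=
    (MvPolynomial.renameEquiv k (Equiv.swap 0 1)).trans (auxE k)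
  have heX : ∀ p : Polynomial k, e.symm (Polynomial.C p) = Polynomial.aeval (X 0) p := by
    intro p
    simp only [e, AlgEquiv.symm_trans_apply, auxE_symm_C]
    rw [← Polynomial.aeval_algHom_apply]
    simp
  let D : Derivation k (Polynomial (Polynomial k)) (Polynomial (Polynomial k)) :=
    Derivation.mk' (e.toLinearMap ∘ₗ d.toLinearMap ∘ₗ e.symm.toLinearMap) (by
      intro a b
      simp)
  have hDapp : ∀ f, D f = e (d (e.symm f)) := fun f => rfl
  obtain ⟨g, hg0, hgu, hgd⟩ := aux_darboux D (by
    intro p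
    rw [hDapp, ← AlgEquiv.eq_symm_apply, heX, heX, Derivation.map_aeval, hd]
    simp) (I.comap (e.symm : Polynomial (Polynomial k) →+* MvPolynomial (Fin 2) k))
    (by
      intro f hf
      simp only [Ideal.mem_comap] at hf ⊢
      rw [hDapp]
      simpa using hI _ hf)
    (by
      intro h
      apply hbot
      rw [eq_bot_iff]
      intro f hf
      have : e f ∈ I.comap (e.symm : Polynomial (Polynomial k) →+* MvPolynomial (Fin 2) k) := by
        simpa using hf
      rw [h] at this
      simpa using this)
    (by
      intro h
      apply htop
      rw [Ideal.eq_top_iff_one] at h ⊢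
      simpa using h)
  refine ⟨e.symm g, by simpa using hg0, ?_, ?_⟩
  · simpa using hgu
  · rw [hDapp] at hgd
    have := map_dvd e.symm hgd
    simpa using this

/-- The exponent of `x^i y^j`. -/
noncomputable def auxN (i j : ℕ) : Fin 2 →₀ ℕ := Finsupp.single 0 i + Finsupp.single 1 j

theorem auxN_zero (i j : ℕ) : auxN i j 0 = i := by simp [auxN]
theorem auxN_one (i j : ℕ) : auxN i j 1 = j := by simp [auxN]

theorem auxN_eta (n : Fin 2 →₀ ℕ) : n = auxN (n 0) (n 1) := by
  ext a; fin_cases a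
  · exact (auxN_zero _ _).symm
  · exact (auxN_one _ _).symm

theorem auxN_le (a b i j : ℕ) : auxN a b ≤ auxN i j ↔ a ≤ i ∧ b ≤ j := by
  constructor
  · intro h
    have h0 := h 0
    have h1 := h 1
    rw [auxN_zero, auxN_zero] at h0
    rw [auxN_one, auxN_one] at h1
    exact ⟨h0, h1⟩
  · rintro ⟨h0, h1⟩ c
    fin_cases c
    · change auxN a b 0 ≤ auxN i j 0
      rwa [auxN_zero, auxN_zero]
    · change auxN a b 1 ≤ auxN i j 1
      rwa [auxN_one, auxN_one]

theorem auxN_sub (a b i j : ℕ) : auxN i j - auxN a b = auxN (i - a) (j - b) := by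
  rw [auxN_eta (auxN i j - auxN a b)]
  simp [auxN_zero, auxN_one]

theorem auxN_add0 (i j : ℕ) : auxN i j + Finsupp.single 0 1 = auxN (i + 1) j := by
  rw [auxN_eta (auxN i j + _)]
  simp [auxN_zero, auxN_one]

theorem auxN_add1 (i j : ℕ) : auxN i j + Finsupp.single 1 1 = auxN i (j + 1) := by
  rw [auxN_eta (auxN i j + _)]
  simp [auxN_zero, auxN_one]

theorem aux_monomial {k : Type*} [Field k] (a b : ℕ) (c : k) :
    monomial (auxN a b) c = C c * X 0 ^ a * X 1 ^ b := by
  rw [auxN, X_pow_eq_monomial, X_pow_eq_monomial, C_mul_monomial, monomial_mul]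
  simp

theorem aux_coeff_mul {k : Type*} [Field k] (a b i j : ℕ) (c : k) (P : MvPolynomial (Fin 2) k) :
    coeff (auxN i j) (C c * X 0 ^ a * X 1 ^ b * P) =
      if a ≤ i ∧ b ≤ j then c * coeff (auxN (i - a) (j - b)) P else 0 := by
  rw [← aux_monomial, coeff_monomial_mul', auxN_sub]
  simp only [auxN_le]

theorem aux_d_eq {k : Type*} [Field k] (s t u : ℕ) (G : MvPolynomial (Fin 2) k) :
    (MvPolynomial.mkDerivation k
            (![1, X 0 ^ u * (X 0 ^ t * X 1 ^ s + 1)] : Fin 2 → MvPolynomial (Fin 2) k)) G =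
    pderiv 0 G + C 1 * X 0 ^ (u + t) * X 1 ^ s * pderiv 1 G
      + C 1 * X 0 ^ u * X 1 ^ 0 * pderiv 1 G := by
  have : MvPolynomial.mkDerivation k
            (![1, X 0 ^ u * (X 0 ^ t * X 1 ^ s + 1)] : Fin 2 → MvPolynomial (Fin 2) k) =
      pderiv 0 + (X 0 ^ u * (X 0 ^ t * X 1 ^ s + 1) : MvPolynomial (Fin 2) k) • pderiv 1 := by
    apply derivation_ext
    intro i
    fin_cases i <;> simp [mkDerivation_X]
  rw [this]
  simp only [Derivation.add_apply, Derivation.smul_apply, smul_eq_mul, map_one, pow_zero]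
  ring

theorem aux_coeff_d {k : Type*} [Field k] (s t u i j : ℕ) (G : MvPolynomial (Fin 2) k) :
    coeff (auxN i j) ((MvPolynomial.mkDerivation k
            (![1, X 0 ^ u * (X 0 ^ t * X 1 ^ s + 1)] : Fin 2 → MvPolynomial (Fin 2) k)) G) =
    coeff (auxN (i + 1) j) G * ((i : k) + 1)
    + (if u + t ≤ i ∧ s ≤ j then
        coeff (auxN (i - (u + t)) (j - s + 1)) G * (((j - s : ℕ) : k) + 1) else 0)
    + (if u ≤ i then coeff (auxN (i - u) (j + 1)) G * ((j : k) + 1) else 0) := by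
  rw [aux_d_eq, coeff_add, coeff_add, aux_coeff_mul, aux_coeff_mul, coeff_pderiv, coeff_pderiv,
    coeff_pderiv, auxN_add0, auxN_add1, auxN_add1, auxN_zero, auxN_one, auxN_one]
  simp

theorem aux_coeff_zero0 {k : Type*} [Field k] {G : MvPolynomial (Fin 2) k} {i j : ℕ}
    (h : degreeOf 0 G < i) : coeff (auxN i j) G = 0 := by
  by_contra hc
  have := monomial_le_degreeOf 0 (mem_support_iff.2 hc)
  rw [auxN_zero] at this
  omega

theorem aux_coeff_zero1 {k : Type*} [Field k] {G : MvPolynomial (Fin 2) k} {i j : ℕ}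
    (h : degreeOf 1 G < j) : coeff (auxN i j) G = 0 := by
  by_contra hc
  have := monomial_le_degreeOf 1 (mem_support_iff.2 hc)
  rw [auxN_one] at this
  omega

theorem aux_deg0 {k : Type*} [Field k] (s t u : ℕ) (G : MvPolynomial (Fin 2) k) :
    degreeOf 0 ((MvPolynomial.mkDerivation k
            (![1, X 0 ^ u * (X 0 ^ t * X 1 ^ s + 1)] : Fin 2 → MvPolynomial (Fin 2) k)) G)
      ≤ degreeOf 0 G + (t + u) := by
  rw [degreeOf_le_iff]
  intro n hn
  by_contra hlt
  rw [mem_support_iff, auxN_eta n, aux_coeff_d] at hn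
  apply hn
  rw [aux_coeff_zero0 (by omega), aux_coeff_zero0 (by omega), aux_coeff_zero0 (by omega)]
  simp

theorem aux_deg1 {k : Type*} [Field k] (s t u : ℕ) (hs : 1 ≤ s) (G : MvPolynomial (Fin 2) k) :
    degreeOf 1 ((MvPolynomial.mkDerivation k
            (![1, X 0 ^ u * (X 0 ^ t * X 1 ^ s + 1)] : Fin 2 → MvPolynomial (Fin 2) k)) G)
      ≤ degreeOf 1 G + (s - 1) := by
  rw [degreeOf_le_iff]
  intro n hn
  by_contra hlt
  rw [mem_support_iff, auxN_eta n, aux_coeff_d] at hn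
  apply hn
  rw [aux_coeff_zero1 (by omega), aux_coeff_zero1 (by omega), aux_coeff_zero1 (by omega)]
  simp

theorem aux_coeff_psi {k : Type*} [Field k] (u : ℕ) (ω : k)
    (ψ : MvPolynomial (Fin 2) k ≃ₐ[k] MvPolynomial (Fin 2) k)
    (hψx : ψ (X 0) = C ω * X 0) (hψy : ψ (X 1) = C (ω ^ (u + 1)) * X 1)
    (P : MvPolynomial (Fin 2) k) (n : Fin 2 →₀ ℕ) :
    coeff n (ψ P) = ω ^ (n 0 + (u + 1) * n 1) * coeff n P := by
  classical
  induction P using MvPolynomial.induction_on' with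
  | add p q hp hq => rw [map_add, coeff_add, coeff_add, hp, hq]; ring
  | monomial m a =>
    have : ψ (monomial m a) = monomial m (ω ^ (m 0 + (u + 1) * m 1) * a) := by
      rw [auxN_eta m, auxN_zero, auxN_one, aux_monomial, aux_monomial, map_mul, map_mul,
        map_pow, map_pow, hψx, hψy]
      have hC : ψ (C a) = C a := ψ.commutes a
      rw [hC]
      simp only [map_mul, map_pow]
      ring
    rw [this, coeff_monomial, coeff_monomial]
    split_ifs with h
    · rw [h]
    · simp

theorem aux_d_psi {k : Type*} [Field k] (s t u v : ℕ) (hv : v = t + (u + 1) * s)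
    (ω : k) (hω : ω ^ v = 1)
    (ψ : MvPolynomial (Fin 2) k ≃ₐ[k] MvPolynomial (Fin 2) k)
    (hψx : ψ (X 0) = C ω * X 0) (hψy : ψ (X 1) = C (ω ^ (u + 1)) * X 1)
    (d : Derivation k (MvPolynomial (Fin 2) k) (MvPolynomial (Fin 2) k))
    (h0 : d (X 0) = 1) (h1 : d (X 1) = X 0 ^ u * (X 0 ^ t * X 1 ^ s + 1))
    (P : MvPolynomial (Fin 2) k) : d (ψ P) = C ω * ψ (d P) := by
  have hdC : ∀ a : k, d (C a) = 0 := fun a => d.map_algebraMap a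
  induction P using MvPolynomial.induction_on with
  | C a =>
    have hC : ψ (C a) = C a := ψ.commutes a
    rw [hC, hdC]; simp
  | add p q hp hq => simp only [map_add, hp, hq]; ring
  | mul_X p i hp =>
    rw [map_mul, d.leibniz, d.leibniz, hp]
    have hXi : d (ψ (X i)) = C ω * ψ (d (X i)) := by
      fin_cases i
      · change d (ψ (X 0)) = C ω * ψ (d (X 0))
        rw [hψx, h0, d.leibniz, h0, hdC]; simp
      · change d (ψ (X 1)) = C ω * ψ (d (X 1))
        rw [hψy, h1, d.leibniz, h1, hdC]
        simp only [map_mul, map_add, map_pow, map_one, hψx, hψy, smul_eq_mul]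
        have : (C ω : MvPolynomial (Fin 2) k) ^ (t + (u + 1) * s) = 1 := by
          rw [← map_pow, ← hv, hω, map_one]
        have h2 : (C ω * X 0 : MvPolynomial (Fin 2) k) ^ t * ((C ω) ^ (u + 1) * X 1) ^ s
            = X 0 ^ t * X 1 ^ s := by
          rw [mul_pow, mul_pow, ← pow_mul]
          calc _ = (C ω : MvPolynomial (Fin 2) k) ^ (t + (u + 1) * s) * (X 0 ^ t * X 1 ^ s) := by
                ring
            _ = _ := by rw [this, one_mul]
        rw [h2]
        ring
    rw [hXi]
    simp only [map_add, smul_eq_mul, map_mul]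
    ring

theorem aux_dvd_mul {A k : Type*} [CommRing k] [CommRing A] [Algebra k A] (d : Derivation k A A)
    {f g : A} (hf : f ∣ d f) (hg : g ∣ d g) : f * g ∣ d (f * g) := by
  rw [d.leibniz, smul_eq_mul, smul_eq_mul, mul_comm g]
  exact dvd_add (mul_dvd_mul_left _ hg) (mul_dvd_mul_right hf _)

theorem aux_dvd_prod {A k : Type*} [CommRing k] [CommRing A] [Algebra k A] (d : Derivation k A A)
    (f : ℕ → A) (hf : ∀ i, f i ∣ d (f i)) (n : ℕ) :
    ∏ i ∈ Finset.range n, f i ∣ d (∏ i ∈ Finset.range n, f i) := by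
  induction n with
  | zero => simp
  | succ n ih => rw [Finset.prod_range_succ]; exact aux_dvd_mul d ih (hf n)

theorem aux_invariant {k : Type*} [Field k] [CharZero k] (s t u v : ℕ)
    (hv : v = t + (u + 1) * s) (hvpos : 0 < v)
    (ω : k) (hω : ω ^ v = 1)
    (ψ : MvPolynomial (Fin 2) k ≃ₐ[k] MvPolynomial (Fin 2) k)
    (hψx : ψ (X 0) = C ω * X 0) (hψy : ψ (X 1) = C (ω ^ (u + 1)) * X 1)
    (d : Derivation k (MvPolynomial (Fin 2) k) (MvPolynomial (Fin 2) k))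
    (h0 : d (X 0) = 1) (h1 : d (X 1) = X 0 ^ u * (X 0 ^ t * X 1 ^ s + 1))
    (hns : ¬ IsSimpleDerivation d) :
    ∃ G : MvPolynomial (Fin 2) k, G ≠ 0 ∧ ¬ IsUnit G ∧ G ∣ d G ∧ ψ G = G := by
  obtain ⟨F, hF0, hFu, hFd⟩ := aux_exists d h0 hns
  have hne : ∀ i : ℕ, ψ^[i] F ≠ 0 := by
    intro i
    induction i with
    | zero => exact hF0
    | succ i ih => rw [Function.iterate_succ_apply']; simpa using ih
  have hdv : ∀ i : ℕ, ψ^[i] F ∣ d (ψ^[i] F) := by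
    intro i
    induction i with
    | zero => exact hFd
    | succ i ih =>
      rw [Function.iterate_succ_apply', aux_d_psi s t u v hv ω hω ψ hψx hψy d h0 h1]
      exact Dvd.dvd.mul_left (map_dvd ψ ih) _
  have hco : ∀ (i : ℕ) (n : Fin 2 →₀ ℕ),
      coeff n (ψ^[i] F) = (ω ^ i) ^ (n 0 + (u + 1) * n 1) * coeff n F := by
    intro i n
    induction i with
    | zero => simp
    | succ i ih =>
      rw [Function.iterate_succ_apply', aux_coeff_psi u ω ψ hψx hψy, ih, pow_succ ω i, mul_pow]
      ring
  have hv' : ψ^[v] F = F := by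
    ext n
    rw [hco, hω]; simp
  refine ⟨∏ i ∈ Finset.range v, ψ^[i] F, Finset.prod_ne_zero_iff.2 fun i _ => hne i, ?_,
    aux_dvd_prod d _ hdv v, ?_⟩
  · intro hu
    have : ψ^[0] F ∣ ∏ i ∈ Finset.range v, ψ^[i] F :=
      Finset.dvd_prod_of_mem (fun i => ψ^[i] F) (Finset.mem_range.2 hvpos)
    exact hFu (isUnit_of_dvd_unit this hu)
  · rw [map_prod]
    have e1 := Finset.prod_range_succ (fun i => ψ^[i] F) v
    rw [Finset.prod_range_succ', hv'] at e1
    have e2 := mul_right_cancel₀ hF0 e1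
    simpa only [Function.iterate_succ_apply'] using e2

theorem aux_coeff_E {k : Type*} [Field k] (P : MvPolynomial (Fin 2) k) (i j : ℕ) :
    coeff (auxN i j) P = ((auxE k P).coeff i).coeff j := by
  classical
  induction P using MvPolynomial.induction_on' with
  | add p q hp hq => simp [hp, hq]
  | monomial n c =>
    rw [auxN_eta n, coeff_monomial, aux_monomial, map_mul, map_mul, map_pow, map_pow, auxE_X0,
      auxE_X1]
    have hC : auxE k (C c) = Polynomial.C (Polynomial.C c) := (auxE k).commutes c
    rw [hC, show Polynomial.C (Polynomial.C c) * Polynomial.X ^ n 0 *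
      (Polynomial.C Polynomial.X : Polynomial (Polynomial k)) ^ n 1 =
      Polynomial.C (Polynomial.C c * Polynomial.X ^ n 1) * Polynomial.X ^ n 0 by
        simp only [map_mul, map_pow]; ring]
    rw [Polynomial.coeff_C_mul_X_pow]
    have hiff : auxN (n 0) (n 1) = auxN i j ↔ n 0 = i ∧ n 1 = j := by
      constructor
      · intro h
        have a := DFunLike.congr_fun h 0
        have b := DFunLike.congr_fun h 1
        rw [auxN_zero, auxN_zero] at a
        rw [auxN_one, auxN_one] at b
        exact ⟨a, b⟩
      · rintro ⟨a, b⟩; rw [a, b]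
    rw [if_congr hiff rfl rfl]
    by_cases h0 : i = n 0
    · rw [if_pos h0, Polynomial.coeff_C_mul_X_pow]
      simp [h0, eq_comm]
    · rw [if_neg h0, if_neg (fun h => h0 h.1.symm), Polynomial.coeff_zero]

theorem darboux_structure_xtys
    (k : Type*) [Field k] [CharZero k] [IsAlgClosed k]
    (s t u : ℕ) (hs : 1 ≤ s) (ht : 1 ≤ t)
    (v : ℕ) (hv : v = t + (u + 1) * s)
    (ω : k) (hω : IsPrimitiveRoot ω v)
    (ψ : MvPolynomial (Fin 2) k ≃ₐ[k] MvPolynomial (Fin 2) k)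
    (hψx : ψ (X 0) = C ω * X 0) (hψy : ψ (X 1) = C (ω ^ (u + 1)) * X 1)
    (hns : ¬ IsSimpleDerivation
      (MvPolynomial.mkDerivation k ![1, X 0 ^ u * (X 0 ^ t * X 1 ^ s + 1)])) :
    ∃ (m b : ℕ) (bc : ℕ → MvPolynomial (Fin 2) k),
      0 < m ∧
      (∀ i, bc i ∈ Algebra.adjoin k {(X 1 : MvPolynomial (Fin 2) k)}) ∧
      ∃ F : MvPolynomial (Fin 2) k,
        F = ∑ i ∈ Finset.range (m + 1), bc i * X 0 ^ i ∧
        (MvPolynomial.mkDerivation k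
            (![1, X 0 ^ u * (X 0 ^ t * X 1 ^ s + 1)] : Fin 2 → MvPolynomial (Fin 2) k)) F =
          (b : MvPolynomial (Fin 2) k) * X 0 ^ (t + u) * X 1 ^ (s - 1) * F ∧
        ψ F = F ∧
        bc m = X 1 ^ b := by
  classical
  have hvpos : 0 < v := by omega
  have h0 : (MvPolynomial.mkDerivation k
      (![1, X 0 ^ u * (X 0 ^ t * X 1 ^ s + 1)] : Fin 2 → MvPolynomial (Fin 2) k)) (X 0) = 1 := by
    simp [mkDerivation_X]
  have h1 : (MvPolynomial.mkDerivation k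
      (![1, X 0 ^ u * (X 0 ^ t * X 1 ^ s + 1)] : Fin 2 → MvPolynomial (Fin 2) k)) (X 1)
        = X 0 ^ u * (X 0 ^ t * X 1 ^ s + 1) := by
    simp [mkDerivation_X]
  obtain ⟨G, hG0, hGu, ⟨Λ, hΛ⟩, hψG⟩ := aux_invariant s t u v hv hvpos ω hω.pow_eq_one ψ hψx hψy _
    h0 h1 hns
  have hcoef := fun i j => aux_coeff_d s t u i j G
  have hd0 := aux_deg0 s t u G
  have hd1 := aux_deg1 s t u hs G
  have hdψ := aux_d_psi s t u v hv ω hω.pow_eq_one ψ hψx hψy _ h0 h1 G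
  rw [hψG, hΛ, map_mul, hψG] at hdψ
  have hΛψ : Λ = C ω * ψ Λ := by
    apply mul_left_cancel₀ hG0
    rw [hdψ]; ring
  -- the cofactor is a single monomial
  have hΛmon : ∃ c : k, Λ = C c * X 0 ^ (t + u) * X 1 ^ (s - 1) := by
    by_cases hΛ0 : Λ = 0
    · exact ⟨0, by simp [hΛ0]⟩
    rw [hΛ, degreeOf_mul_eq hG0 hΛ0] at hd0 hd1
    refine ⟨coeff (auxN (t + u) (s - 1)) Λ, ?_⟩
    rw [← aux_monomial]
    ext n
    rw [coeff_monomial]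
    split_ifs with h
    · rw [h]
    by_contra hc
    have hn0 := monomial_le_degreeOf 0 (mem_support_iff.2 hc)
    have hn1 := monomial_le_degreeOf 1 (mem_support_iff.2 hc)
    have e1 := congrArg (coeff n) hΛψ
    rw [coeff_C_mul, aux_coeff_psi u ω ψ hψx hψy, ← mul_assoc, ← pow_succ'] at e1
    have e2 : ω ^ (n 0 + (u + 1) * n 1 + 1) = 1 := by
      apply mul_right_cancel₀ hc
      rw [← e1, one_mul]
    have e3 := Nat.le_of_dvd (by omega) ((hω.pow_eq_one_iff_dvd _).1 e2)
    have hn1' : n 1 ≤ s - 1 := by omega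
    have hn0' : n 0 ≤ t + u := by omega
    obtain ⟨r, hr⟩ : ∃ r, s = n 1 + 1 + r := ⟨s - 1 - n 1, by omega⟩
    have e4 : (u + 1) * s = (u + 1) * n 1 + (u + 1) + (u + 1) * r := by rw [hr]; ring
    have hr0 : r = 0 := by
      by_contra hr0
      have : 1 * 1 ≤ (u + 1) * r := Nat.mul_le_mul (by omega) (by omega)
      omega
    subst hr0
    apply h
    rw [auxN_eta n, show n 0 = t + u by omega, show n 1 = s - 1 by omega]
  obtain ⟨c, hc⟩ := hΛmon
  -- the key coefficient identity
  have key : ∀ i j, coeff (auxN i j) (C c * X 0 ^ (t + u) * X 1 ^ (s - 1) * G) =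
      coeff (auxN i j) ((MvPolynomial.mkDerivation k
        (![1, X 0 ^ u * (X 0 ^ t * X 1 ^ s + 1)] : Fin 2 → MvPolynomial (Fin 2) k)) G) :=
    fun i j => (by rw [← hc, mul_comm, ← hΛ])
  simp only [aux_coeff_mul, hcoef] at key
  set m := degreeOf 0 G with hm
  have htop : ∀ l : ℕ, coeff (auxN m l) G * ((l : k) - c) = 0 := by
    intro l
    have h := key (m + (t + u)) (s - 1 + l)
    rw [if_pos ⟨by omega, by omega⟩, aux_coeff_zero0 (G := G) (i := m + (t + u) + 1) (by omega),
      aux_coeff_zero0 (G := G) (i := m + (t + u) - u) (by omega)] at h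
    rw [show m + (t + u) - (t + u) = m by omega, show m + (t + u) - (u + t) = m by omega,
      show s - 1 + l - (s - 1) = l by omega] at h
    rcases Nat.eq_zero_or_pos l with hl | hl
    · subst hl
      rw [if_neg (by omega)] at h
      simp only [zero_mul, add_zero, ite_self, mul_eq_zero] at h
      rcases h with h | h <;> simp [h]
    · rw [if_pos (by omega), show s - 1 + l - s + 1 = l by omega] at h
      have hl' : ((s - 1 + l - s : ℕ) : k) + 1 = (l : k) := by
        have : s - 1 + l - s + 1 = l := by omega
        exact_mod_cast congrArg (Nat.cast : ℕ → k) this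
      rw [hl'] at h
      simp only [zero_mul, add_zero, zero_add, ite_self] at h
      rw [mul_sub, ← h]; ring
  -- some top coefficient is nonzero
  have hexb : ∃ b : ℕ, coeff (auxN m b) G ≠ 0 := by
    by_contra hcon
    push Not at hcon
    have hz : ∀ n ∈ G.support, n 0 ≠ m := by
      intro n hn he
      rw [mem_support_iff, auxN_eta n, he] at hn
      exact hn (hcon _)
    rcases Nat.eq_zero_or_pos m with h | h
    · obtain ⟨n, hn⟩ := (support_nonempty.2 hG0)
      have := monomial_le_degreeOf 0 hn
      exact hz n hn (by omega)
    · have : degreeOf 0 G < m := (degreeOf_lt_iff h).2 fun n hn =>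
        lt_of_le_of_ne (monomial_le_degreeOf 0 hn) (hz n hn)
      omega
  obtain ⟨b, hb⟩ := hexb
  have hcb : c = b := by
    have := (mul_eq_zero.1 (htop b)).resolve_left hb
    exact (sub_eq_zero.1 this).symm
  have honly : ∀ l, l ≠ b → coeff (auxN m l) G = 0 := by
    intro l hl
    refine (mul_eq_zero.1 (htop l)).resolve_right ?_
    rw [hcb, sub_eq_zero]
    exact_mod_cast hl
  have hmpos : 0 < m := by
    by_contra hm0
    have hm0 : m = 0 := by omega
    rw [hm0] at hb honly
    have hGeq : G = monomial (auxN 0 b) (coeff (auxN 0 b) G) := by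
      ext n
      rw [coeff_monomial]
      split_ifs with h
      · rw [h]
      · rw [auxN_eta n]
        rcases Nat.eq_zero_or_pos (n 0) with h' | h'
        · rw [h']
          apply honly
          intro h2
          apply h
          rw [auxN_eta n, h', h2]
        · exact aux_coeff_zero0 (by omega)
    rcases Nat.eq_zero_or_pos b with hb0 | hbp
    · apply hGu
      rw [hGeq, aux_monomial, hb0]
      rw [hb0] at hb
      simpa using hb
    · have h := key u (b - 1)
      rw [if_neg (by omega), if_neg (by omega), if_pos le_rfl,
        aux_coeff_zero0 (G := G) (i := u + 1) (by omega),
        show u - u = 0 by omega, show b - 1 + 1 = b by omega] at h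
      have hb1 : ((b - 1 : ℕ) : k) + 1 = (b : k) := by
        have : b - 1 + 1 = b := by omega
        exact_mod_cast congrArg (Nat.cast : ℕ → k) this
      rw [hb1] at h
      have hbk : (b : k) ≠ 0 := by exact_mod_cast hbp.ne'
      simp [hb, hbk] at h
  -- normalise
  have hF : ∀ i j, coeff (auxN i j) (C (coeff (auxN m b) G)⁻¹ * G) =
      (coeff (auxN m b) G)⁻¹ * coeff (auxN i j) G := fun i j => coeff_C_mul _ _ _
  refine ⟨m, b, fun i => Polynomial.aeval (X 1)
    ((auxE k (C (coeff (auxN m b) G)⁻¹ * G)).coeff i), hmpos,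
    fun i => Polynomial.aeval_mem_adjoin_singleton _ _, C (coeff (auxN m b) G)⁻¹ * G, ?_, ?_, ?_, ?_⟩
  · apply (auxE k).injective
    have hdeg : (auxE k (C (coeff (auxN m b) G)⁻¹ * G)).natDegree < m + 1 := by
      rw [Nat.lt_succ_iff, Polynomial.natDegree_le_iff_coeff_eq_zero]
      intro N hN
      ext j
      rw [← aux_coeff_E, hF, aux_coeff_zero0 (G := G) (i := N) (by omega)]
      simp
    rw [map_sum]
    conv_lhs => rw [Polynomial.as_sum_range_C_mul_X_pow' _ hdeg]
    refine Finset.sum_congr rfl fun i _ => ?_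
    beta_reduce
    rw [← auxE_symm_C, map_mul (auxE k) ((auxE k).symm _), map_pow, auxE_X0,
      AlgEquiv.apply_symm_apply]
  · rw [Derivation.leibniz, hΛ, hc, hcb]
    have hdC : ∀ (d : Derivation k (MvPolynomial (Fin 2) k) (MvPolynomial (Fin 2) k)) (a : k),
      d (C a) = 0 := fun d a => d.map_algebraMap a
    rw [hdC, smul_zero, add_zero, smul_eq_mul, map_natCast]
    ring
  · rw [map_mul, hψG]
    congr 1
    exact ψ.commutes _
  · have : (auxE k (C (coeff (auxN m b) G)⁻¹ * G)).coeff m = Polynomial.X ^ b := by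
      ext j
      rw [← aux_coeff_E, hF, Polynomial.coeff_X_pow]
      split_ifs with h
      · rw [h]; exact inv_mul_cancel₀ hb
      · rw [honly j h, mul_zero]
    simp only [this, map_pow, Polynomial.aeval_X]
end

section
/- Let $k$ be an algebraically closed field of characteristic zero, let $s \geq 2$, $t \geq 1$ and $u \geq 0$ be integers, set $v = (s-1)t + (u+1)s$, let $\omega \in k$ be a primitive $v$-th root of unity, and let $\psi$ be the $k$-algebra automorphism of $k[x,y]$ with $\psi(x) = \omega x$ and $\psi(y) = \omega^{u+t+1} y$. Let $d = \partial_x + x^u(x^t + y^s)\partial_y$. If $d$ is not a simple derivation of $k[x,y]$, then there exist a polynomial $F \in k[x,y]$ of positive degree $m$ in $x$, written $F = \sum_{i=0}^{m} b_i x^i$ with $b_i \in k[y]$, and an element $b \in k$, such that $d(F) = b\, x^{u} y^{s-1} F$, $\psi(F) = F$, and $b_m = 1$. -/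
open MvPolynomial

namespace DarbouxAux

lemma gauss_dvd {R : Type*} [CommRing R] [IsDomain R] [UniqueFactorizationMonoid R]
    (p g : Polynomial R) (c : R) (hp : p.IsPrimitive) (hc : c ≠ 0)
    (h : p ∣ Polynomial.C c * g) : p ∣ g := by
  classical
  let : StrongNormalizationMonoid R := Classical.arbitrary _
  let : StrongNormalizedGCDMonoid R := UniqueFactorizationMonoid.toStrongNormalizedGCDMonoid R
  obtain ⟨q, hq⟩ := h
  have h1 : c ∣ q.content := by
    have h2 : c ∣ (Polynomial.C c * g).content :=
      Polynomial.dvd_content_iff_C_dvd.2 (dvd_mul_right _ _)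
    rw [hq, Polynomial.content_mul, hp.content_eq_one, one_mul] at h2
    exact h2
  obtain ⟨q', rfl⟩ := Polynomial.dvd_content_iff_C_dvd.1 h1
  refine ⟨q', ?_⟩
  have hc' : (Polynomial.C c) ≠ 0 := by simpa using hc
  apply mul_left_cancel₀ hc'
  rw [hq]; ring

lemma pseudo_dvd {R : Type*} [CommRing R] [IsDomain R] (I : Ideal (Polynomial R))
    (f : Polynomial R) (hf : f ∈ I) (hf0 : f ≠ 0)
    (hmin : ∀ g ∈ I, g ≠ 0 → f.natDegree ≤ g.natDegree) :
    ∀ (n : ℕ) (g : Polynomial R), g ∈ I → g.natDegree < n →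
      ∃ c : R, c ≠ 0 ∧ f ∣ Polynomial.C c * g := by
  intro n
  induction n with
  | zero => intro g _ h; omega
  | succ n ih =>
    intro g hg hn
    by_cases hg0 : g = 0
    · exact ⟨1, one_ne_zero, by simp [hg0]⟩
    have hle := hmin g hg hg0
    set a := f.leadingCoeff with ha
    have ha0 : a ≠ 0 := by simpa [ha] using hf0
    have hb0 : g.leadingCoeff ≠ 0 := by simpa using hg0
    set r := Polynomial.C a * g -
      Polynomial.C g.leadingCoeff * Polynomial.X ^ (g.natDegree - f.natDegree) * f with hr
    have hrI : r ∈ I := I.sub_mem (I.mul_mem_left _ hg) (I.mul_mem_left _ hf)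
    have hdvd : ∀ c : R, f ∣ Polynomial.C c * r → f ∣ Polynomial.C (c * a) * g := by
      intro c hc
      have : Polynomial.C (c * a) * g = Polynomial.C c * r +
        Polynomial.C c * (Polynomial.C g.leadingCoeff *
          Polynomial.X ^ (g.natDegree - f.natDegree)) * f := by
        rw [hr, Polynomial.C_mul]; ring
      rw [this]
      exact dvd_add hc (dvd_mul_left _ _)
    by_cases hr0 : r = 0
    · exact ⟨1 * a, by simpa using ha0, hdvd 1 (by simp [hr0])⟩
    have hdeg : r.degree < (Polynomial.C a * g).degree := by
      apply Polynomial.degree_sub_lt_left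
      · rw [Polynomial.degree_mul, Polynomial.degree_mul, Polynomial.degree_mul,
          Polynomial.degree_C ha0, Polynomial.degree_C hb0, Polynomial.degree_X_pow,
          Polynomial.degree_eq_natDegree hf0, Polynomial.degree_eq_natDegree hg0]
        norm_cast
        omega
      · exact mul_ne_zero (by simpa using ha0) hg0
      · simp [Polynomial.leadingCoeff_mul, ha]; ring
    have hlt : r.natDegree < g.natDegree := by
      rw [Polynomial.degree_mul, Polynomial.degree_C ha0, zero_add] at hdeg
      exact Polynomial.natDegree_lt_natDegree hr0 hdeg
    obtain ⟨c, hc, hd⟩ := ih r hrI (by omega)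
    exact ⟨c * a, mul_ne_zero hc ha0, hdvd c hd⟩

lemma darboux_poly {k : Type*} [Field k] [CharZero k]
    (D : Derivation k (Polynomial (Polynomial k)) (Polynomial (Polynomial k)))
    (hδ : ∀ r : Polynomial k, D (Polynomial.C r) = Polynomial.C (Polynomial.derivative r))
    (I : Ideal (Polynomial (Polynomial k))) (hI : ∀ f ∈ I, D f ∈ I) (hne : I ≠ ⊥)
    (hnt : I ≠ ⊤) : ∃ p, p ≠ 0 ∧ ¬ IsUnit p ∧ p ∣ D p := by
  classical
  obtain ⟨f1, hf1, hf10⟩ := Submodule.exists_mem_ne_zero_of_ne_bot hne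
  obtain ⟨f, ⟨hf, hf0⟩, hmin'⟩ := WellFounded.has_min
    (measure (Polynomial.natDegree (R := Polynomial k))).wf {f | f ∈ I ∧ f ≠ 0} ⟨f1, hf1, hf10⟩
  have hmin : ∀ g ∈ I, g ≠ 0 → f.natDegree ≤ g.natDegree := by
    intro g hg hg0
    have := hmin' g ⟨hg, hg0⟩
    simpa [measure, InvImage, WellFoundedRelation.rel] using this
  by_cases hd : f.natDegree = 0
  · exfalso
    obtain ⟨r, rfl⟩ := Polynomial.natDegree_eq_zero.1 hd
    have key : ∀ (n : ℕ) (r : Polynomial k), r.natDegree < n → r ≠ 0 →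
        Polynomial.C r ∈ I → False := by
      intro n
      induction n with
      | zero => intro r h; omega
      | succ n ih =>
        intro r hn hr0 hrI
        by_cases h0 : r.natDegree = 0
        · obtain ⟨c, rfl⟩ := Polynomial.natDegree_eq_zero.1 h0
          apply hnt
          apply Ideal.eq_top_of_isUnit_mem _ hrI
          have : c ≠ 0 := by rintro rfl; simp at hr0
          exact (this.isUnit.map Polynomial.C).map Polynomial.C
        · have h1 := hI _ hrI
          rw [hδ] at h1
          refine ih _ ?_ ?_ h1
          · have := Polynomial.natDegree_derivative_lt h0
            omega
          · intro h
            exact h0 (Polynomial.derivative_eq_zero.1 h)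
    exact key _ r (Nat.lt_succ_self _) (by rintro rfl; simp at hf0) hf
  · letI : StrongNormalizationMonoid (Polynomial k) := Classical.arbitrary _
    let : StrongNormalizedGCDMonoid (Polynomial k) :=
      UniqueFactorizationMonoid.toStrongNormalizedGCDMonoid _
    obtain ⟨e, p, hfe, hprim⟩ : ∃ (e : Polynomial k) (p : Polynomial (Polynomial k)),
        f = Polynomial.C e * p ∧ p.IsPrimitive :=
      ⟨_, _, Polynomial.eq_C_content_mul_primPart f, f.isPrimitive_primPart⟩
    have he : e ≠ 0 := by rintro rfl; simp at hfe; exact hf0 hfe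
    have hp0 : p ≠ 0 := hprim.ne_zero
    refine ⟨p, hp0, ?_, ?_⟩
    · intro hu
      apply hd
      rw [hfe, Polynomial.natDegree_C_mul he]
      exact Polynomial.natDegree_eq_zero_of_isUnit hu
    · obtain ⟨c, hc, hdv⟩ := pseudo_dvd I f hf hf0 hmin _ (D f) (hI f hf) (Nat.lt_succ_self _)
      have h1 : p ∣ Polynomial.C c * D f := (Dvd.intro_left _ hfe.symm).trans hdv
      have h2 := gauss_dvd _ _ _ hprim hc h1
      rw [hfe, Derivation.leibniz] at h2
      have h3 : p ∣ Polynomial.C e * D p := by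
        simp only [smul_eq_mul] at h2
        exact (dvd_add_left (dvd_mul_right _ _)).1 h2
      exact gauss_dvd _ _ _ hprim he h3

/-- transport to `MvPolynomial`. -/
lemma darboux_mv {k : Type*} [Field k] [CharZero k]
    (d : Derivation k (MvPolynomial (Fin 2) k) (MvPolynomial (Fin 2) k))
    (hd : d (X 0) = 1)
    (I : Ideal (MvPolynomial (Fin 2) k)) (hI : ∀ f ∈ I, d f ∈ I) (hne : I ≠ ⊥)
    (hnt : I ≠ ⊤) : ∃ p, p ≠ 0 ∧ ¬ IsUnit p ∧ p ∣ d p := by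
  let e := Polynomial.Bivariate.equivMvPolynomial k
  let D : Derivation k (Polynomial (Polynomial k)) (Polynomial (Polynomial k)) :=
    Derivation.mk' (e.symm.toLinearMap ∘ₗ d.toLinearMap ∘ₗ e.toLinearMap) (by
      intro a b
      simp [Derivation.leibniz])
  have hD : ∀ f, D f = e.symm (d (e f)) := fun f => rfl
  have hδ : ∀ r : Polynomial k, D (Polynomial.C r) = Polynomial.C (Polynomial.derivative r) := by
    intro r
    have hX : D (Polynomial.C Polynomial.X) = 1 := by rw [hD]; simp [e, hd]
    have hC : ∀ c : k, D (Polynomial.C (Polynomial.C c)) = 0 := by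
      intro c; rw [hD]; simp [e]
    induction r using Polynomial.induction_on' with
    | add p q hp hq => simp [hp, hq]
    | monomial n c =>
      rw [← Polynomial.C_mul_X_pow_eq_monomial, Polynomial.C_mul, Polynomial.C_pow,
        Derivation.leibniz, Derivation.leibniz_pow, hX, hC]
      simp [Polynomial.derivative_X_pow]
  obtain ⟨p, hp0, hpu, q, hq⟩ := darboux_poly D hδ (I.comap e)
    (by intro f hf; rw [Ideal.mem_comap, hD]; simpa using hI _ hf)
    (by
      obtain ⟨f1, hf1, hf10⟩ := Submodule.exists_mem_ne_zero_of_ne_bot hne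
      intro h
      have : e.symm f1 ∈ I.comap e := by simpa using hf1
      rw [h] at this
      simp at this
      exact hf10 this)
    (by
      intro h
      apply hnt
      rw [Ideal.eq_top_iff_one] at h ⊢
      simpa using h)
  refine ⟨e p, by simpa using hp0, by simpa using hpu, e q, ?_⟩
  rw [← map_mul, ← hq, hD]; simp

end DarbouxAux

namespace DarbouxAux

noncomputable def theta (k : Type*) [Field k] (w : Fin 2 → ℕ) :
    MvPolynomial (Fin 2) k →ₐ[k] Polynomial (MvPolynomial (Fin 2) k) :=
  aeval (fun i => Polynomial.C (X i) * Polynomial.X ^ (w i))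

def wt (w : Fin 2 → ℕ) (m : Fin 2 →₀ ℕ) : ℕ := m 0 * w 0 + m 1 * w 1

lemma monomial_two {k : Type*} [CommSemiring k] (m : Fin 2 →₀ ℕ) (c : k) :
    monomial m c = C c * X 0 ^ m 0 * X 1 ^ m 1 := by
  rw [monomial_eq, Finsupp.prod_fintype _ _ (by simp)]
  simp [Fin.prod_univ_two, mul_assoc]

lemma theta_monomial {k : Type*} [Field k] (w : Fin 2 → ℕ) (m : Fin 2 →₀ ℕ) (c : k) :
    theta k w (monomial m c) = Polynomial.monomial (wt w m) (monomial m c) := by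
  rw [← Polynomial.C_mul_X_pow_eq_monomial, monomial_two]
  simp [theta, wt, mul_pow, ← pow_mul, pow_add, IsScalarTower.algebraMap_apply k (MvPolynomial (Fin 2) k) (Polynomial (MvPolynomial (Fin 2) k)), mul_comm (w _)]
  ring

lemma coeff_theta {k : Type*} [Field k] (w : Fin 2 → ℕ) (F : MvPolynomial (Fin 2) k)
    (n : ℕ) (m : Fin 2 →₀ ℕ) :
    coeff m ((theta k w F).coeff n) = if wt w m = n then coeff m F else 0 := by
  classical
  induction F using MvPolynomial.induction_on' with
  | monomial a c =>
    rw [theta_monomial, Polynomial.coeff_monomial, coeff_monomial]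
    by_cases h : a = m
    · subst h; rw [if_pos rfl]; split_ifs <;> simp
    · split_ifs <;> simp [coeff_monomial, h]
  | add p q hp hq =>
    rw [map_add, Polynomial.coeff_add, coeff_add, hp, hq, coeff_add]
    split_ifs <;> simp

noncomputable def wd {k : Type*} [Field k] (w : Fin 2 → ℕ) (F : MvPolynomial (Fin 2) k) : ℕ :=
  (theta k w F).natDegree

lemma le_wd {k : Type*} [Field k] (w : Fin 2 → ℕ) (F : MvPolynomial (Fin 2) k)
    (m : Fin 2 →₀ ℕ) (h : coeff m F ≠ 0) : wt w m ≤ wd w F := by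
  apply Polynomial.le_natDegree_of_ne_zero
  intro h0
  have := coeff_theta w F (wt w m) m
  rw [h0] at this
  simp at this
  exact h this.symm

lemma wd_le {k : Type*} [Field k] (w : Fin 2 → ℕ) (F : MvPolynomial (Fin 2) k)
    (N : ℕ) (h : ∀ m, coeff m F ≠ 0 → wt w m ≤ N) : wd w F ≤ N := by
  apply Polynomial.natDegree_le_iff_coeff_eq_zero.2
  intro n hn
  ext m
  rw [coeff_theta]
  split_ifs with h1
  · by_contra h2
    have := h m h2
    omega
  · simp

lemma theta_ne {k : Type*} [Field k] (w : Fin 2 → ℕ) (F : MvPolynomial (Fin 2) k)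
    (hF : F ≠ 0) : theta k w F ≠ 0 := by
  obtain ⟨m, hm⟩ := MvPolynomial.ne_zero_iff.1 hF
  intro h0
  have := coeff_theta w F (wt w m) m
  rw [h0] at this
  simp at this
  exact hm this.symm

lemma wd_mul {k : Type*} [Field k] (w : Fin 2 → ℕ) (F G : MvPolynomial (Fin 2) k)
    (hF : F ≠ 0) (hG : G ≠ 0) : wd w (F * G) = wd w F + wd w G := by
  unfold wd
  rw [map_mul, Polynomial.natDegree_mul (theta_ne w F hF) (theta_ne w G hG)]

/-- the derivation -/
noncomputable abbrev dd (k : Type*) [Field k] (s t u : ℕ) :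
    Derivation k (MvPolynomial (Fin 2) k) (MvPolynomial (Fin 2) k) :=
  MvPolynomial.mkDerivation k ![1, X 0 ^ u * (X 0 ^ t + X 1 ^ s)]

noncomputable def ex (i j : ℕ) : Fin 2 →₀ ℕ := Finsupp.single 0 i + Finsupp.single 1 j

@[simp] lemma ex_zero (i j : ℕ) : ex i j 0 = i := by simp [ex]
@[simp] lemma ex_one (i j : ℕ) : ex i j 1 = j := by simp [ex]

lemma eq_ex (m : Fin 2 →₀ ℕ) : m = ex (m 0) (m 1) := by
  ext i; fin_cases i <;> simp

lemma dd_apply {k : Type*} [Field k] (s t u : ℕ) (F : MvPolynomial (Fin 2) k) :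
    dd k s t u F = pderiv 0 F + monomial (ex (u + t) 0) 1 * pderiv 1 F
      + monomial (ex u s) 1 * pderiv 1 F := by
  have : dd k s t u = pderiv 0 + (monomial (ex (u + t) 0) (1 : k)) • pderiv 1
      + (monomial (ex u s) (1 : k)) • pderiv 1 := by
    apply MvPolynomial.derivation_ext
    intro i
    fin_cases i
    · simp [mkDerivation_X, pderiv_X]
    · simp [mkDerivation_X, pderiv_X, monomial_two]
      ring
  rw [this]; simp

lemma coeff_pd0 {k : Type*} [Field k] (F : MvPolynomial (Fin 2) k) (m : Fin 2 →₀ ℕ) :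
    coeff m (pderiv 0 F) = coeff (ex (m 0 + 1) (m 1)) F * (m 0 + 1) := by
  rw [coeff_pderiv]
  congr 2
  ext i; fin_cases i <;> simp

lemma coeff_pd1 {k : Type*} [Field k] (F : MvPolynomial (Fin 2) k) (m : Fin 2 →₀ ℕ) :
    coeff m (pderiv 1 F) = coeff (ex (m 0) (m 1 + 1)) F * (m 1 + 1) := by
  rw [coeff_pderiv]
  congr 2
  ext i; fin_cases i <;> simp

lemma ex_le (a b : ℕ) (m : Fin 2 →₀ ℕ) : ex a b ≤ m ↔ a ≤ m 0 ∧ b ≤ m 1 := by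
  rw [Finsupp.le_def, Fin.forall_fin_two]; simp

lemma coeff_dd {k : Type*} [Field k] (s t u : ℕ) (F : MvPolynomial (Fin 2) k) (m : Fin 2 →₀ ℕ) :
    coeff m (dd k s t u F) = coeff (ex (m 0 + 1) (m 1)) F * (m 0 + 1)
     + (if u + t ≤ m 0 then coeff (ex (m 0 - (u + t)) (m 1 + 1)) F * (m 1 + 1) else 0)
     + (if u ≤ m 0 ∧ s ≤ m 1 then
          coeff (ex (m 0 - u) (m 1 - s + 1)) F * ((m 1 - s : ℕ) + 1) else 0) := by
  rw [dd_apply, coeff_add, coeff_add, coeff_pd0, coeff_monomial_mul', coeff_monomial_mul',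
    coeff_pd1, coeff_pd1]
  simp [ex_le]

lemma dd_wd {k : Type*} [Field k] (s t u : ℕ) (w : Fin 2 → ℕ) (c : ℕ)
    (h1 : w 0 * (u + t) ≤ c + w 1) (h2 : w 0 * u + s * w 1 ≤ c + w 1)
    (F : MvPolynomial (Fin 2) k) : wd w (dd k s t u F) ≤ wd w F + c := by
  apply wd_le
  intro m hm
  rw [coeff_dd] at hm
  by_cases ha : coeff (ex (m 0 + 1) (m 1)) F = 0
  · by_cases hb : u + t ≤ m 0 ∧ coeff (ex (m 0 - (u + t)) (m 1 + 1)) F ≠ 0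
    · have := le_wd w F _ hb.2
      obtain ⟨q, hq⟩ := Nat.exists_eq_add_of_le hb.1
      simp only [wt, ex_zero, ex_one] at *
      rw [hq] at *
      simp only [Nat.add_sub_cancel_left] at this
      nlinarith
    · by_cases hc : (u ≤ m 0 ∧ s ≤ m 1) ∧ coeff (ex (m 0 - u) (m 1 - s + 1)) F ≠ 0
      · have := le_wd w F _ hc.2
        obtain ⟨q, hq⟩ := Nat.exists_eq_add_of_le hc.1.1
        obtain ⟨r, hr⟩ := Nat.exists_eq_add_of_le hc.1.2
        simp only [wt, ex_zero, ex_one] at *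
        rw [hq, hr] at *
        simp only [Nat.add_sub_cancel_left] at this
        nlinarith
      · exfalso
        apply hm
        rw [ha]
        split_ifs with h1 h2 h2 <;> simp_all
  · have := le_wd w F _ ha
    simp only [wt, ex_zero, ex_one] at *
    nlinarith

end DarbouxAux

namespace DarbouxAux

section
variable {k : Type*} [Field k] (s t u v : ℕ) (ω : k)
    (ψ : MvPolynomial (Fin 2) k ≃ₐ[k] MvPolynomial (Fin 2) k)

lemma psi_monomial
    (hψx : ψ (X 0) = C ω * X 0) (hψy : ψ (X 1) = C (ω ^ (u + t + 1)) * X 1)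
    (m : Fin 2 →₀ ℕ) (c : k) :
    ψ (monomial m c) = monomial m (ω ^ (m 0 + (u + t + 1) * m 1) * c) := by
  have hc : ψ (C c) = C c := ψ.commutes c
  rw [monomial_two, monomial_two, map_mul, map_mul, map_pow, map_pow, hψx, hψy, hc]
  simp only [mul_pow, C_mul, C_pow, pow_add, pow_mul]
  ring

lemma coeff_psi
    (hψx : ψ (X 0) = C ω * X 0) (hψy : ψ (X 1) = C (ω ^ (u + t + 1)) * X 1)
    (m : Fin 2 →₀ ℕ) (F : MvPolynomial (Fin 2) k) :
    coeff m (ψ F) = ω ^ (m 0 + (u + t + 1) * m 1) * coeff m F := by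
  classical
  induction F using MvPolynomial.induction_on' with
  | monomial a c =>
    rw [psi_monomial t u ω ψ hψx hψy, coeff_monomial, coeff_monomial]
    by_cases h : a = m
    · subst h; simp
    · simp [h]
  | add p q hp hq => rw [map_add, coeff_add, hp, hq, coeff_add]; ring

lemma dd_psi (hs : 2 ≤ s) (hv : v = (s - 1) * t + (u + 1) * s) (hω : ω ^ v = 1)
    (hψx : ψ (X 0) = C ω * X 0) (hψy : ψ (X 1) = C (ω ^ (u + t + 1)) * X 1)
    (F : MvPolynomial (Fin 2) k) :
    dd k s t u (ψ F) = C ω * ψ (dd k s t u F) := by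
  have hc : ∀ c, ψ (C c) = C c := fun c => ψ.commutes c
  induction F using MvPolynomial.induction_on with
  | C a => simp [hc]
  | add p q hp hq => simp only [map_add, hp, hq]; ring
  | mul_X p i hp =>
    have hX : dd k s t u (ψ (X i)) = C ω * ψ (dd k s t u (X i)) := by
      fin_cases i
      · simp [hψx, Derivation.leibniz, mkDerivation_X]
      · have h1 : (u + t + 1) * s = v + t := by
          obtain ⟨r, rfl⟩ : ∃ r, s = r + 1 := ⟨s - 1, by omega⟩
          rw [hv]; simp only [Nat.add_sub_cancel]; ring
        have h2 : (C ω : MvPolynomial (Fin 2) k) ^ ((u + t + 1) * s) = C ω ^ t := by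
          rw [h1, ← C_pow, pow_add, hω, one_mul, C_pow]
        simp only [Fin.mk_one, hψy]
        rw [Derivation.leibniz, derivation_C, smul_zero, add_zero, smul_eq_mul]
        simp only [hψy, mkDerivation_X, Matrix.cons_val_one, Matrix.cons_val_zero, map_mul, map_add,
          map_pow, hψx, mul_pow, ← pow_mul, h2]
        ring
    rw [map_mul, Derivation.leibniz, Derivation.leibniz, hX, hp]
    simp only [smul_eq_mul, map_add, map_mul]
    ring

lemma psi_iter (hω : ω ^ v = 1)
    (hψx : ψ (X 0) = C ω * X 0) (hψy : ψ (X 1) = C (ω ^ (u + t + 1)) * X 1)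
    (F : MvPolynomial (Fin 2) k) : ψ^[v] F = F := by
  have h : ∀ n m, coeff m (ψ^[n] F) = (ω ^ (m 0 + (u + t + 1) * m 1)) ^ n * coeff m F := by
    intro n m
    induction n with
    | zero => simp
    | succ n ih =>
      rw [Function.iterate_succ_apply', coeff_psi t u ω ψ hψx hψy, ih]; ring
  ext m
  rw [h, ← pow_mul, mul_comm _ v, pow_mul, hω, one_pow, one_mul]

lemma exists_invariant (hs : 2 ≤ s) (hv : v = (s - 1) * t + (u + 1) * s) (hω : ω ^ v = 1)
    (hψx : ψ (X 0) = C ω * X 0) (hψy : ψ (X 1) = C (ω ^ (u + t + 1)) * X 1)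
    (p : MvPolynomial (Fin 2) k) (hp0 : p ≠ 0) (hpu : ¬ IsUnit p) (hp : p ∣ dd k s t u p) :
    ∃ G, G ≠ 0 ∧ ¬ IsUnit G ∧ G ∣ dd k s t u G ∧ ψ G = G := by
  have hv0 : 0 < v := by
    have : 0 < (u + 1) * s := by positivity
    omega
  have hi : ∀ n, ψ^[n] p ≠ 0 ∧ ψ^[n] p ∣ dd k s t u (ψ^[n] p) := by
    intro n
    induction n with
    | zero => exact ⟨hp0, hp⟩
    | succ n ih =>
      rw [Function.iterate_succ_apply']
      refine ⟨by simpa using ih.1, ?_⟩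
      rw [dd_psi s t u v ω ψ hs hv hω hψx hψy]
      exact Dvd.dvd.mul_left (map_dvd ψ ih.2) _
  refine ⟨∏ i ∈ Finset.range v, ψ^[i] p, ?_, ?_, ?_, ?_⟩
  · exact Finset.prod_ne_zero_iff.2 fun i _ => (hi i).1
  · intro h
    apply hpu
    have := isUnit_of_dvd_unit (Finset.dvd_prod_of_mem (fun i => ψ^[i] p)
      (Finset.mem_range.2 hv0)) h
    simpa using this
  · generalize v = n
    induction n with
    | zero => simp
    | succ n ih =>
      rw [Finset.prod_range_succ, Derivation.leibniz]
      simp only [smul_eq_mul]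
      apply dvd_add
      · exact mul_dvd_mul_left _ (hi n).2
      · rw [mul_comm]; exact mul_dvd_mul_left _ ih
  · rw [map_prod]
    simp only [← Function.iterate_succ_apply' ψ]
    apply mul_right_cancel₀ hp0
    have h1 := Finset.prod_range_succ' (fun i => ψ^[i] p) v
    rw [Finset.prod_range_succ, psi_iter t u v ω ψ hω hψx hψy] at h1
    simpa using h1.symm

lemma cofactor (hs : 2 ≤ s) (hv : v = (s - 1) * t + (u + 1) * s) (hω : IsPrimitiveRoot ω v)
    (hψx : ψ (X 0) = C ω * X 0) (hψy : ψ (X 1) = C (ω ^ (u + t + 1)) * X 1)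
    (G L : MvPolynomial (Fin 2) k) (hG0 : G ≠ 0) (hG : dd k s t u G = G * L) (hψG : ψ G = G) :
    ∃ b : k, L = C b * X 0 ^ u * X 1 ^ (s - 1) := by
  classical
  by_cases hL0 : L = 0
  · exact ⟨0, by simp [hL0]⟩
  have hinv : L = C ω * ψ L := by
    have h := dd_psi s t u v ω ψ hs hv hω.pow_eq_one hψx hψy G
    rw [hψG, hG, map_mul, hψG] at h
    apply mul_left_cancel₀ hG0
    rw [h]; ring
  obtain ⟨r, rfl⟩ : ∃ r, s = r + 1 := ⟨s - 1, by omega⟩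
  simp only [Nat.add_sub_cancel] at hv ⊢
  have key : ∀ m, coeff m L ≠ 0 → m = ex u r := by
    intro m hm
    have h1 : v ∣ 1 + (m 0 + (u + t + 1) * m 1) := by
      apply hω.dvd_of_pow_eq_one
      have h := congrArg (coeff m) hinv
      rw [coeff_C_mul, coeff_psi t u ω ψ hψx hψy, ← mul_assoc, ← pow_succ'] at h
      rw [add_comm 1]
      exact mul_right_cancel₀ hm (by rw [one_mul]; exact h.symm)
    have bound : ∀ (w : Fin 2 → ℕ) (c : ℕ), w 0 * (u + t) ≤ c + w 1 →
        w 0 * u + (r + 1) * w 1 ≤ c + w 1 → wt w m ≤ c := by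
      intro w c ha hb
      have h := dd_wd (r + 1) t u w c ha hb G
      rw [hG, wd_mul w G L hG0 hL0] at h
      have := le_wd w L m hm
      omega
    have hy := bound ![0, 1] r (by simp) (by simp)
    have hw := bound ![r + 1, t] ((r + 1) * u + r * t)
      (by simp; nlinarith) (by simp; nlinarith)
    simp [wt] at hy hw
    generalize hi : m 0 = i at *
    generalize hj : m 1 = j at *
    have h2 : v ∣ (r + 1) * i + t * j + (r + 1) := by
      have h3 : v ∣ (r + 1) * (1 + (i + (u + t + 1) * j)) := h1.mul_left _
      have h4 : (r + 1) * (1 + (i + (u + t + 1) * j)) =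
        v * j + ((r + 1) * i + t * j + (r + 1)) := by rw [hv]; ring
      rw [h4] at h3
      exact (Nat.dvd_add_right (dvd_mul_right _ _)).1 h3
    have h5 : (r + 1) * i + t * j + (r + 1) = v := by
      apply le_antisymm
      · rw [hv]; nlinarith
      · exact Nat.le_of_dvd (by omega) h2
    obtain ⟨c, hc⟩ := Nat.exists_eq_add_of_le hy
    have h6 : (r + 1) * i = (r + 1) * u + t * c := by
      rw [hc] at hv; nlinarith
    obtain ⟨q, hq⟩ := h1
    have h7 : v * ((r + 1) * q) = v * (j + 1) := by
      have : (r + 1) * (v * q) = v * j + ((r + 1) * i + t * j + (r + 1)) := by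
        rw [← hq, hv]; ring
      rw [h5] at this
      linarith
    have hvpos : 0 < v := by
      rw [hv]; positivity
    have h8 : (r + 1) * q = j + 1 := Nat.eq_of_mul_eq_mul_left hvpos h7
    have h9 : r + 1 ≤ j + 1 := Nat.le_of_dvd (by omega) ⟨q, h8.symm⟩
    have h10 : j = r := by omega
    have h11 : c = 0 := by omega
    have h12 : i = u := by
      rw [h11] at h6
      exact Nat.eq_of_mul_eq_mul_left (Nat.succ_pos r) (by simpa using h6)
    rw [eq_ex m, hi, hj, h10, h12]
  refine ⟨coeff (ex u r) L, ?_⟩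
  have : C (coeff (ex u r) L) * X 0 ^ u * X 1 ^ r = monomial (ex u r) (coeff (ex u r) L) := by
    rw [monomial_two]; simp
  rw [this]
  ext m
  rw [coeff_monomial]
  by_cases h : m = ex u r
  · simp [h]
  · rw [if_neg (Ne.symm h)]
    by_contra h'
    exact h (key m h')

lemma top_x [CharZero k] (ht : 1 ≤ t) (b : k) (G : MvPolynomial (Fin 2) k)
    (hG : dd k s t u G = C b * X 0 ^ u * X 1 ^ (s - 1) * G)
    (M : ℕ) (hM : ∀ m, coeff m G ≠ 0 → m 0 ≤ M) (j : ℕ) (hj : 0 < j) :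
    coeff (ex M j) G = 0 := by
  obtain ⟨j, rfl⟩ : ∃ i, j = i + 1 := ⟨j - 1, by omega⟩
  have hz : ∀ i j, M < i → coeff (ex i j) G = 0 := by
    intro i j hi
    by_contra h
    have := hM _ h
    simp at this
    omega
  have h := congrArg (coeff (ex (M + u + t) j)) hG
  have hm : C b * X 0 ^ u * X 1 ^ (s - 1) = monomial (ex u (s - 1)) b := by
    rw [monomial_two]; simp
  rw [coeff_dd, hm, coeff_monomial_mul'] at h
  simp only [ex_zero, ex_one] at h
  have e1 : M + u + t - (u + t) = M := by omega
  have e2 : ∀ n, coeff (ex (M + u + t - u) n) G = 0 := fun n => hz _ _ (by omega)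
  have e3 : coeff (ex (M + u + t) j - ex u (s - 1)) G = 0 := by
    rw [eq_ex (ex (M + u + t) j - ex u (s - 1))]
    apply hz
    simp; omega
  rw [hz _ _ (by omega), e1, e2, e3, if_pos (by omega)] at h
  simp at h
  rcases h with h | h
  · exact h
  · exact absurd h (by exact_mod_cast Nat.succ_ne_zero j)

end

end DarbouxAux

theorem darboux_structure_xt_ys
    (k : Type*) [Field k] [CharZero k] [IsAlgClosed k]
    (s t u : ℕ) (hs : 2 ≤ s) (ht : 1 ≤ t)
    (v : ℕ) (hv : v = (s - 1) * t + (u + 1) * s)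
    (ω : k) (hω : IsPrimitiveRoot ω v)
    (ψ : MvPolynomial (Fin 2) k ≃ₐ[k] MvPolynomial (Fin 2) k)
    (hψx : ψ (X 0) = C ω * X 0) (hψy : ψ (X 1) = C (ω ^ (u + t + 1)) * X 1)
    (hns : ¬ IsSimpleDerivation
      (MvPolynomial.mkDerivation k ![1, X 0 ^ u * (X 0 ^ t + X 1 ^ s)])) :
    ∃ (m : ℕ) (b : k) (bc : ℕ → MvPolynomial (Fin 2) k),
      0 < m ∧
      (∀ i, bc i ∈ Algebra.adjoin k {(X 1 : MvPolynomial (Fin 2) k)}) ∧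
      ∃ F : MvPolynomial (Fin 2) k,
        F = ∑ i ∈ Finset.range (m + 1), bc i * X 0 ^ i ∧
        (MvPolynomial.mkDerivation k
            (![1, X 0 ^ u * (X 0 ^ t + X 1 ^ s)] : Fin 2 → MvPolynomial (Fin 2) k)) F =
          C b * X 0 ^ u * X 1 ^ (s - 1) * F ∧
        ψ F = F ∧
        bc m = 1 := by
  classical
  unfold IsSimpleDerivation at hns
  push Not at hns
  obtain ⟨I, hI, hne, hnt⟩ := hns
  obtain ⟨p, hp0, hpu, hp⟩ := DarbouxAux.darboux_mv _ (by simp [mkDerivation_X]) I hI hne hnt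
  have hv0 : v ≠ 0 := by
    have : 0 < (u + 1) * s := by positivity
    omega
  obtain ⟨G, hG0, hGu, ⟨L, hGL⟩, hψG⟩ := DarbouxAux.exists_invariant s t u v ω ψ hs hv
    hω.pow_eq_one hψx hψy p hp0 hpu hp
  obtain ⟨b, hb⟩ := DarbouxAux.cofactor s t u v ω ψ hs hv hω hψx hψy G L hG0 hGL hψG
  have hG : DarbouxAux.dd k s t u G = C b * X 0 ^ u * X 1 ^ (s - 1) * G := by
    rw [hGL, hb]; ring
  obtain ⟨mm, hmm, hmax⟩ := Finset.exists_max_image G.support (fun m => m 0)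
    (by simpa using hG0)
  set M := mm 0 with hMdef
  have hM : ∀ m, coeff m G ≠ 0 → m 0 ≤ M := fun m hm => hmax m (mem_support_iff.2 hm)
  have htop := DarbouxAux.top_x s t u ht b G hG M hM
  have hmm0 : coeff mm G ≠ 0 := mem_support_iff.1 hmm
  have hmm1 : mm = DarbouxAux.ex M 0 := by
    by_contra h
    have h1 : 0 < mm 1 := by
      by_contra h2
      apply h
      rw [DarbouxAux.eq_ex mm]
      congr 1
      omega
    apply hmm0
    rw [DarbouxAux.eq_ex mm]
    exact htop _ h1
  set a := coeff (DarbouxAux.ex M 0) G with ha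
  have ha0 : a ≠ 0 := by rw [ha, ← hmm1]; exact hmm0
  have huniq : ∀ m, coeff m G ≠ 0 → m 0 = M → m = DarbouxAux.ex M 0 := by
    intro m hm h
    have h1 : m 1 = 0 := by
      by_contra h2
      apply hm
      rw [DarbouxAux.eq_ex m, h]
      exact htop _ (Nat.pos_of_ne_zero h2)
    rw [DarbouxAux.eq_ex m, h, h1]
  have hMpos : 0 < M := by
    by_contra hM0
    have hM0 : M = 0 := by omega
    apply hGu
    have : G = C a := by
      ext m
      rw [coeff_C]
      have hz : DarbouxAux.ex M 0 = 0 := by rw [hM0]; simp [DarbouxAux.ex]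
      split_ifs with h
      · rw [← h, ha, hz]
      · by_contra h'
        apply h
        rw [huniq m h' (by have := hM m h'; omega), hz]
    rw [this]
    exact ha0.isUnit.map C
  refine ⟨M, b, fun i => ∑ m ∈ G.support with m 0 = i, C (a⁻¹ * coeff m G) * X 1 ^ (m 1),
    hMpos, ?_, C a⁻¹ * G, ?_, ?_, ?_, ?_⟩
  · intro i
    refine Subalgebra.sum_mem _ fun m _ => ?_
    rw [← smul_eq_C_mul]
    exact Subalgebra.smul_mem _
      (Subalgebra.pow_mem _ (Algebra.subset_adjoin (Set.mem_singleton _)) _) _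
  · have h1 : ∀ i ∈ Finset.range (M + 1),
        (∑ m ∈ G.support with m 0 = i, C (a⁻¹ * coeff m G) * X 1 ^ (m 1)) * X 0 ^ i =
        ∑ m ∈ G.support with m 0 = i, C a⁻¹ * monomial m (coeff m G) := by
      intro i _
      rw [Finset.sum_mul]
      refine Finset.sum_congr rfl fun m hm => ?_
      rw [DarbouxAux.monomial_two, (Finset.mem_filter.1 hm).2, C_mul]
      ring
    have h2 : ∀ m ∈ G.support, m 0 ∈ Finset.range (M + 1) := by
      intro m hm
      have := hmax m hm
      simp only [Finset.mem_range]
      omega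
    have h3 := Finset.sum_fiberwise_of_maps_to h2
      (fun m => C a⁻¹ * monomial m (coeff m G))
    have h4 : ∑ m ∈ G.support, C a⁻¹ * monomial m (coeff m G) = C a⁻¹ * G := by
      rw [← Finset.mul_sum, support_sum_monomial_coeff]
    exact h4.symm.trans (h3.symm.trans (Finset.sum_congr rfl h1).symm)
  · rw [Derivation.leibniz, derivation_C, smul_zero, add_zero, smul_eq_mul]
    have hG' := hG
    unfold DarbouxAux.dd at hG'
    rw [hG']; ring
  · rw [map_mul, hψG]
    congr 1
    exact ψ.commutes _
  · have : G.support.filter (fun m => m 0 = M) = {DarbouxAux.ex M 0} := by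
      ext m
      simp only [Finset.mem_filter, mem_support_iff, Finset.mem_singleton]
      constructor
      · rintro ⟨h1, h2⟩; exact huniq m h1 h2
      · rintro rfl; exact ⟨ha0, by simp⟩
    simp only [this, Finset.sum_singleton]
    rw [← ha, inv_mul_cancel₀ ha0, DarbouxAux.ex_one, C_1, pow_zero, one_mul]
end
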